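/- Fix a Gorenstein h-vector h (i.e., a sequence arising as the Hilbert function of some standard graded artinian Gorenstein algebra over an algebraically closed field of characteristic zero) with Sperner number at most 6. Then every artinian Gorenstein algebra with Hilbert function h has the weak Lefschetz property if and only if h is not one of (1,5,5,1), (1,6,6,1), (1,6,6,6,1). -/

import Mathlib

open MvPolynomial

noncomputable section

variable {K : Type*} [Field K] {n : ℕ}

/-- The degree `i` graded piece of the standard graded algebra `R/I`,
where `R = K[x_1,…,x_n]`. -/
def piece (I : Ideal (MvPolynomial (Fin n) K)) (i : ℕ) :
    Submodule K (MvPolynomial (Fin n) K ⧸ I) :=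
  (homogeneousSubmodule (Fin n) K i).map (Ideal.Quotient.mkₐ K I).toLinearMap

/-- The Hilbert function of the standard graded algebra `R/I`. -/
def hf (I : Ideal (MvPolynomial (Fin n) K)) (i : ℕ) : ℕ :=
  Module.finrank K (piece I i)

/-- `I` is a homogeneous ideal. -/
def IsHomogIdeal (I : Ideal (MvPolynomial (Fin n) K)) : Prop :=
  ∀ p ∈ I, ∀ i : ℕ, homogeneousComponent i p ∈ I

/-- The socle of `R/I`: the annihilator of the irrelevant maximal ideal. -/
def socle (I : Ideal (MvPolynomial (Fin n) K)) :
    Submodule K (MvPolynomial (Fin n) K ⧸ I) :=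
  ⨅ j : Fin n, LinearMap.ker (LinearMap.mulLeft K (Ideal.Quotient.mk I (X j)))

/-- `R/I` is a standard graded artinian Gorenstein algebra of socle degree `d`:
`I` is homogeneous, the Hilbert function vanishes above degree `d`, is symmetric,
and the socle is one-dimensional, concentrated in degree `d`. -/
def IsArtinianGorenstein (I : Ideal (MvPolynomial (Fin n) K)) (d : ℕ) : Prop :=
  IsHomogIdeal I ∧ hf I d = 1 ∧ (∀ i : ℕ, d < i → hf I i = 0) ∧
    (∀ i : ℕ, i ≤ d → hf I i = hf I (d - i)) ∧
    Module.finrank K (socle I) = 1 ∧ socle I ≤ piece I d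

/-- The weak Lefschetz property for `R/I`: there is a linear form `ℓ` such that
multiplication `×ℓ : [A]_i → [A]_{i+1}` has maximal rank (is injective or
surjective) for every `i`. -/
def WLP (I : Ideal (MvPolynomial (Fin n) K)) : Prop :=
  ∃ ℓ : MvPolynomial (Fin n) K, ℓ.IsHomogeneous 1 ∧ ∀ i : ℕ,
    (∀ a ∈ piece I i, Ideal.Quotient.mk I ℓ * a = 0 → a = 0) ∨
    (∀ b ∈ piece I (i + 1), ∃ a ∈ piece I i, Ideal.Quotient.mk I ℓ * a = b)

/-- The strong Lefschetz property for `R/I`: there is a linear form `ℓ` such that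
`×ℓ^k : [A]_i → [A]_{i+k}` has maximal rank for all `i ≥ 0`, `k ≥ 1`. -/
def SLP (I : Ideal (MvPolynomial (Fin n) K)) : Prop :=
  ∃ ℓ : MvPolynomial (Fin n) K, ℓ.IsHomogeneous 1 ∧ ∀ i k : ℕ, 1 ≤ k →
    ((∀ a ∈ piece I i, Ideal.Quotient.mk I ℓ ^ k * a = 0 → a = 0) ∨
     (∀ b ∈ piece I (i + k), ∃ a ∈ piece I i, Ideal.Quotient.mk I ℓ ^ k * a = b))

/-- The action of `p ∈ R = K[x_1,…,x_n]` on `S = K[X_1,…,X_n]` by differentiation,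
`x_i` acting as `∂/∂X_i`. -/
def diffOp (p : MvPolynomial (Fin n) K) :
    Module.End K (MvPolynomial (Fin n) K) :=
  ∑ m ∈ p.support, MvPolynomial.coeff m p •
    (List.ofFn fun j : Fin n =>
      ((pderiv j).toLinearMap : Module.End K (MvPolynomial (Fin n) K)) ^ (m j)).prod

/-- The degree-`d` graded piece of the inverse system `I^⊥ = {F : g ∘ F = 0 ∀ g ∈ I}`. -/
def invSys (I : Ideal (MvPolynomial (Fin n) K)) (d : ℕ) :
    Submodule K (MvPolynomial (Fin n) K) :=
  homogeneousSubmodule (Fin n) K d ⊓ ⨅ g ∈ I, LinearMap.ker (diffOp g)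

end


section Abstract

variable {K : Type*} [Field K] {n : ℕ}

/-- A property of points of `K^n` holding on a nonempty Zariski-open set. -/
def Gen (p : (Fin n → K) → Prop) : Prop :=
  ∃ f : MvPolynomial (Fin n) K, f ≠ 0 ∧ ∀ t, eval t f ≠ 0 → p t

theorem Gen.and {p q : (Fin n → K) → Prop} (hp : Gen p) (hq : Gen q) :
    Gen (fun t => p t ∧ q t) := by
  obtain ⟨f, hf, hf'⟩ := hp
  obtain ⟨g, hg, hg'⟩ := hq
  refine ⟨f * g, mul_ne_zero hf hg, fun t ht => ?_⟩
  rw [map_mul] at ht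
  exact ⟨hf' t (left_ne_zero_of_mul ht), hg' t (right_ne_zero_of_mul ht)⟩

theorem Gen.mono {p q : (Fin n → K) → Prop} (hp : Gen p) (h : ∀ t, p t → q t) : Gen q := by
  obtain ⟨f, hf, hf'⟩ := hp
  exact ⟨f, hf, fun t ht => h t (hf' t ht)⟩

theorem Gen.exists [Infinite K] {p : (Fin n → K) → Prop} (hp : Gen p) : ∃ t, p t := by
  obtain ⟨f, hf, hf'⟩ := hp
  by_contra! hcon
  apply hf
  apply MvPolynomial.funext
  intro t
  by_contra h
  exact hcon t (hf' t (by simpa using h))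

theorem Gen.forall_finset {ι : Type*} (s : Finset ι) {p : ι → (Fin n → K) → Prop}
    (hp : ∀ i ∈ s, Gen (p i)) : Gen (fun t => ∀ i ∈ s, p i t) := by
  classical
  induction s using Finset.induction_on with
  | empty => exact ⟨1, one_ne_zero, by simp⟩
  | insert a s ha ih =>
    have h1 := (hp a (by simp)).and (ih (fun i hi => hp i (by simp [hi])))
    refine h1.mono ?_
    rintro t ⟨h2, h3⟩ i hi
    rcases Finset.mem_insert.1 hi with rfl | hi
    · exact h2
    · exact h3 i hi

/-- von Neumann regularity of linear maps over a field. -/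
theorem exists_gen_inverse {F V W : Type*} [Field F] [AddCommGroup V] [Module F V]
    [AddCommGroup W] [Module F W] (f : V →ₗ[F] W) : ∃ g : W →ₗ[F] V, f ∘ₗ g ∘ₗ f = f := by
  obtain ⟨s, hs⟩ := f.rangeRestrict.exists_rightInverse_of_surjective
    (LinearMap.range_eq_top.2 f.surjective_rangeRestrict)
  obtain ⟨g, hg⟩ := LinearMap.exists_extend s
  refine ⟨g, ?_⟩
  ext v
  have h1 : g (f v) = s (f.rangeRestrict v) := by
    rw [← hg]; rfl
  have h2 := congrArg (fun h => (h (f.rangeRestrict v) : W)) hs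
  simp only [LinearMap.comp_apply] at h2 ⊢
  rw [h1]
  exact h2

/-- Matrix version over the polynomial ring, with cleared denominators. -/
theorem exists_matrix_gen_inverse {R : Type*} [CommRing R] [IsDomain R] {p q : Type*} [Fintype p]
    [Fintype q] [DecidableEq p] [DecidableEq q] (M : Matrix q p R) :
    ∃ (g : R) (G : Matrix p q R), g ≠ 0 ∧ M * G * M = g • M := by
  classical
  let F := FractionRing R
  let MF : Matrix q p F := M.map (algebraMap R F)
  obtain ⟨G0, hG0⟩ := exists_gen_inverse (Matrix.toLin' MF)
  let G1 : Matrix p q F := LinearMap.toMatrix' G0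
  have h1 : MF * G1 * MF = MF := by
    apply Matrix.toLin'.injective
    rw [Matrix.toLin'_mul, Matrix.toLin'_mul, Matrix.toLin'_toMatrix']
    rw [LinearMap.comp_assoc]; exact hG0
  obtain ⟨b, hb⟩ := IsLocalization.exist_integer_multiples_of_finset (nonZeroDivisors R)
    (Finset.univ.image (fun ij : p × q => G1 ij.1 ij.2))
  have hb' : ∀ i j, ∃ r : R, algebraMap R F r = (b : R) • G1 i j := by
    intro i j
    exact hb _ (Finset.mem_image.2 ⟨(i, j), Finset.mem_univ _, rfl⟩)
  choose G hG using hb'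
  refine ⟨b, Matrix.of G, nonZeroDivisors.ne_zero b.2, ?_⟩
  have hmap : (Matrix.of G).map (algebraMap R F) = (b : R) • G1 := by
    ext i j; simp [hG]
  apply Matrix.map_injective (IsFractionRing.injective R F)
  change (M * Matrix.of G * M).map (algebraMap R F) = ((b : R) • M).map (algebraMap R F)
  rw [Matrix.map_mul, Matrix.map_mul, hmap]
  change MF * ((b : R) • G1) * MF = _
  rw [Matrix.mul_smul, Matrix.smul_mul, h1]
  ext i j
  simp [MF, Algebra.smul_def]

variable {A : Type*} [CommRing A] [Algebra K A]

/-- Evaluation at a `K`-point of a polynomial with coefficients in `A`. -/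
noncomputable def ev (A : Type*) [CommRing A] [Algebra K A] (t : Fin n → K) :
    MvPolynomial (Fin n) A →+* A :=
  eval (fun j => algebraMap K A (t j))

theorem ev_map (t : Fin n → K) (c : MvPolynomial (Fin n) K) :
    ev A t (map (algebraMap K A) c) = algebraMap K A (eval t c) := by
  rw [ev, eval_map]
  induction c using MvPolynomial.induction_on with
  | C a => simp
  | add p q hp hq => simp [hp, hq]
  | mul_X p i hp => simp [hp]

theorem ev_C (t : Fin n → K) (a : A) : ev A t (C a) = a := by simp [ev]

theorem ev_mem (t : Fin n → K) (U : Submodule K A) (p : MvPolynomial (Fin n) A)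
    (hp : ∀ m, coeff m p ∈ U) : ev A t p ∈ U := by
  rw [ev, eval_eq]
  refine Submodule.sum_mem _ fun m _ => ?_
  have : ∏ i ∈ m.support, (algebraMap K A (t i)) ^ m i
      = algebraMap K A (∏ i ∈ m.support, t i ^ m i) := by simp
  rw [this, mul_comm, ← Algebra.smul_def]
  exact U.smul_mem _ (hp m)

theorem exists_repr {ι : Type*} [Fintype ι] (b : Module.Basis ι K A)
    (p : MvPolynomial (Fin n) A) : ∃ c : ι → MvPolynomial (Fin n) K,
      p = ∑ i, map (algebraMap K A) (c i) * C (b i) := by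
  induction p using MvPolynomial.induction_on with
  | C a =>
    refine ⟨fun i => C (b.repr a i), ?_⟩
    conv_lhs => rw [← b.sum_repr a]
    simp [Algebra.smul_def]
  | add p q hp hq =>
    obtain ⟨c, hc⟩ := hp
    obtain ⟨e, he⟩ := hq
    exact ⟨fun i => c i + e i, by simp only [map_add, add_mul, Finset.sum_add_distrib, ← hc, ← he]⟩
  | mul_X p j hp =>
    obtain ⟨c, hc⟩ := hp
    refine ⟨fun i => c i * X j, ?_⟩
    rw [hc, Finset.sum_mul]
    refine Finset.sum_congr rfl fun i _ => ?_
    simp only [map_mul, map_X]; ring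

/-- Generic kernel vectors lift to polynomial families of kernel vectors. -/
theorem lifting [Module.Finite K A] (U : Submodule K A) (θ : MvPolynomial (Fin n) A) :
    Gen (fun t : Fin n → K => ∀ a ∈ U, ev A t θ * a = 0 →
      ∃ P : MvPolynomial (Fin n) A, (∀ m, coeff m P ∈ U) ∧ θ * P = 0 ∧ ev A t P = a) := by
  classical
  let u := Module.finBasis K U
  let b := Module.finBasis K A
  choose M0 hM0 using fun j => exists_repr b (θ * C (u j : A))
  obtain ⟨g, G, hg, hG⟩ := exists_matrix_gen_inverse (Matrix.of fun i j => M0 j i)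
  set M : Matrix _ _ (MvPolynomial (Fin n) K) := Matrix.of fun i j => M0 j i with hM
  refine ⟨g, hg, fun t ht a ha h0 => ?_⟩
  let v := u.repr ⟨a, ha⟩
  have hv : a = ∑ j, v j • (u j : A) := by
    have := congrArg U.subtype (u.sum_repr ⟨a, ha⟩)
    rw [map_sum] at this
    exact this.symm
  have hMv : ∀ i, ∑ j, eval t (M i j) * v j = 0 := by
    have h1 : ∑ i, (∑ j, eval t (M i j) * v j) • b i = 0 := by
      rw [← h0, hv, Finset.mul_sum]
      have h2 : ∀ j, ev A t θ * (v j • (u j : A)) = ∑ i, (eval t (M i j) * v j) • b i := by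
        intro j
        have h3 := congrArg (ev A t) (hM0 j)
        rw [map_mul, ev_C, map_sum] at h3
        rw [mul_smul_comm, h3, Finset.smul_sum]
        refine Finset.sum_congr rfl fun i _ => ?_
        rw [map_mul, ev_C, ev_map, ← Algebra.smul_def, smul_smul, mul_comm]
        rfl
      simp_rw [h2]
      rw [Finset.sum_comm]
      refine Finset.sum_congr rfl fun i _ => ?_
      rw [Finset.sum_smul]
    exact Fintype.linearIndependent_iff.1 b.linearIndependent _ h1
  let w : Fin _ → MvPolynomial (Fin n) K := fun j => C (v j)
  let vh := g • w - (G * M).mulVec w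
  have hMvh : M.mulVec vh = 0 := by
    simp only [vh]
    rw [Matrix.mulVec_sub, Matrix.mulVec_smul, Matrix.mulVec_mulVec, ← Matrix.mul_assoc, hG,
      Matrix.smul_mulVec, sub_self]
  have hvt : ∀ j, eval t (vh j) = eval t g * v j := by
    intro j
    have h4 : eval t ((G * M).mulVec w j) = 0 := by
      rw [← Matrix.mulVec_mulVec]
      simp only [Matrix.mulVec, dotProduct, map_sum, map_mul]
      refine Finset.sum_eq_zero fun i _ => ?_
      simp only [w, eval_C, hMv, mul_zero]
    simp only [vh, Pi.sub_apply, map_sub, h4, sub_zero, Pi.smul_apply, smul_eq_mul, map_mul, w,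
      eval_C]
  let c0 : K := (eval t g)⁻¹
  refine ⟨∑ j, C (algebraMap K A c0) * (map (algebraMap K A) (vh j) * C (u j : A)), ?_, ?_, ?_⟩
  · intro m
    rw [coeff_sum]
    refine Submodule.sum_mem _ fun j _ => ?_
    rw [coeff_C_mul, mul_comm (map _ _), coeff_C_mul, coeff_map, mul_comm (u j : A), ← Algebra.smul_def, ← Algebra.smul_def]
    exact U.smul_mem _ (U.smul_mem _ (u j).2)
  · rw [← Finset.mul_sum, mul_left_comm]
    convert mul_zero _
    rw [Finset.mul_sum]
    have h5 : ∀ j, θ * (map (algebraMap K A) (vh j) * C (u j : A))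
        = ∑ i, map (algebraMap K A) (M i j * vh j) * C (b i) := by
      intro j
      rw [mul_left_comm, hM0 j, Finset.mul_sum]
      refine Finset.sum_congr rfl fun i _ => ?_
      simp only [map_mul, hM, Matrix.of_apply]; ring
    simp_rw [h5]
    rw [Finset.sum_comm]
    refine Finset.sum_eq_zero fun i _ => ?_
    rw [← Finset.sum_mul, ← map_sum]
    have : ∑ j, M i j * vh j = 0 := congrFun hMvh i
    rw [this]; simp
  · rw [map_sum, hv]
    refine Finset.sum_congr rfl fun j _ => ?_
    rw [map_mul, map_mul, ev_C, ev_C, ev_map, hvt, ← Algebra.smul_def, ← Algebra.smul_def,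
      smul_smul]
    congr 1
    simp only [c0]
    rw [inv_mul_cancel_left₀ ht]

end Abstract



section Abstract2

variable {K : Type*} [Field K] {n : ℕ} {A : Type*} [CommRing A] [Algebra K A]

/-- Abstract standard graded Gorenstein algebra. -/
structure GA (K : Type*) [Field K] {n : ℕ} {A : Type*} [CommRing A] [Algebra K A]
    (x : Fin n → A) (V : ℕ → Submodule K A) (d : ℕ) : Prop where
  one_mem : (1 : A) ∈ V 0
  mul_mem : ∀ {i j : ℕ} {a b : A}, a ∈ V i → b ∈ V j → a * b ∈ V (i + j)
  x_mem : ∀ j, x j ∈ V 1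
  zero_le : V 0 ≤ Submodule.span K {1}
  succ_le : ∀ i, V (i + 1) ≤ Submodule.span K {z | ∃ j, ∃ a ∈ V i, z = x j * a}
  nd : ∀ {i : ℕ} {a : A}, i < d → a ∈ V i → (∀ j, x j * a = 0) → a = 0
  top : Module.finrank K (V d) = 1

/-- The linear form with coefficients `t`. -/
def lin (x : Fin n → A) (t : Fin n → K) : A := ∑ j, t j • x j

/-- The space of multiples of `a` by degree `j` elements has dimension at most one. -/
def R1 (V : ℕ → Submodule K A) (j : ℕ) (a : A) : Prop :=
  ∃ w : A, ∀ p ∈ V j, ∃ c : K, p * a = c • w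

/-- The space of multiples of `a` by degree `j` elements. -/
def MulS (V : ℕ → Submodule K A) (j : ℕ) (a : A) : Submodule K A :=
  (V j).map (LinearMap.mulRight K a)

theorem mem_MulS {V : ℕ → Submodule K A} {j : ℕ} {a z : A} :
    z ∈ MulS V j a ↔ ∃ p ∈ V j, p * a = z := by
  simp [MulS]

theorem two_le_of_not_R1 [Module.Finite K A] {V : ℕ → Submodule K A} {j : ℕ} {a : A}
    (h : ¬ R1 V j a) : 2 ≤ Module.finrank K (MulS V j a) := by
  by_contra hlt
  apply h
  have h1 : Module.finrank K (MulS V j a) ≤ 1 := by omega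
  obtain ⟨v, hv⟩ := finrank_le_one_iff.1 h1
  refine ⟨v, fun p hp => ?_⟩
  obtain ⟨c, hc⟩ := hv ⟨p * a, mem_MulS.2 ⟨p, hp, rfl⟩⟩
  exact ⟨c, by rw [← Submodule.coe_smul, hc]⟩

theorem finrank_sup_ge [Module.Finite K A] (G E : Submodule K A) (f : A →ₗ[K] A)
    (hG : G ≤ LinearMap.ker f) :
    Module.finrank K G + Module.finrank K (E.map f) ≤ Module.finrank K (G ⊔ E : Submodule K A) := by
  have h := LinearMap.finrank_range_add_finrank_ker (f.domRestrict (G ⊔ E))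
  rw [LinearMap.range_domRestrict] at h
  have h1 : Module.finrank K (E.map f) ≤ Module.finrank K ((G ⊔ E).map f) :=
    Submodule.finrank_mono (Submodule.map_mono le_sup_right)
  have h2 : Module.finrank K G ≤ Module.finrank K (LinearMap.ker (f.domRestrict (G ⊔ E))) := by
    let i : G →ₗ[K] LinearMap.ker (f.domRestrict (G ⊔ E)) :=
      LinearMap.codRestrict _ (Submodule.inclusion le_sup_left) (fun c => by
        simpa using hG c.2)
    apply LinearMap.finrank_le_finrank_of_injective (f := i)
    intro a b hab
    have h3 : ((i a : (G ⊔ E : Submodule K A)) : A) = ((i b : (G ⊔ E : Submodule K A)) : A) := by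
      rw [hab]
    exact Subtype.ext h3
  omega

/-- exact rank-nullity for the restriction to a submodule -/
theorem finrank_map_add [Module.Finite K A] (E : Submodule K A) (f : A →ₗ[K] A) :
    Module.finrank K (E.map f) + Module.finrank K (E ⊓ LinearMap.ker f : Submodule K A)
      = Module.finrank K E := by
  have h := LinearMap.finrank_range_add_finrank_ker (f.domRestrict E)
  rw [LinearMap.range_domRestrict] at h
  have h2 : LinearMap.ker (f.domRestrict E) = (LinearMap.ker f).comap E.subtype := by
    ext z; simp
  rw [← h, h2]
  congr 1
  rw [← Submodule.map_comap_subtype]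
  exact Submodule.finrank_map_subtype_eq _ _

variable {x : Fin n → A} {V : ℕ → Submodule K A} {d : ℕ}

theorem lin_mem (hA : GA K x V d) (t : Fin n → K) : lin x t ∈ V 1 :=
  Submodule.sum_mem _ fun j _ => Submodule.smul_mem _ _ (hA.x_mem j)

theorem GA.exists_lin (hA : GA K x V d) {y : A} (hy : y ∈ V 1) : ∃ t : Fin n → K, y = lin x t := by
  have h1 : V 1 ≤ Submodule.span K (Set.range x) := by
    refine (hA.succ_le 0).trans (Submodule.span_le.2 ?_)
    rintro z ⟨j, a, ha, rfl⟩
    obtain ⟨c, rfl⟩ := Submodule.mem_span_singleton.1 (hA.zero_le ha)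
    rw [mul_smul_comm, mul_one]
    exact Submodule.smul_mem _ _ (Submodule.subset_span ⟨j, rfl⟩)
  obtain ⟨t, ht⟩ := (Submodule.mem_span_range_iff_exists_fun K).1 (h1 hy)
  exact ⟨t, ht.symm⟩

theorem GA.nz (hA : GA K x V d) {i : ℕ} {a : A} (hi : i < d) (ha : a ∈ V i) (h0 : a ≠ 0) :
    ∃ j, x j * a ≠ 0 := by
  by_contra! h
  exact h0 (hA.nd hi ha h)

theorem GA.pairing (hA : GA K x V d) {i j : ℕ} (hij : i + j = d) {a : A} (ha : a ∈ V i)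
    (h0 : a ≠ 0) : ∃ b ∈ V j, b * a ≠ 0 := by
  induction j generalizing i a with
  | zero => exact ⟨1, hA.one_mem, by simpa using h0⟩
  | succ j ih =>
    obtain ⟨s, hs⟩ := hA.nz (by omega) ha h0
    obtain ⟨b, hb, hb'⟩ := ih (i := 1 + i) (by omega) (hA.mul_mem (hA.x_mem s) ha) hs
    refine ⟨b * x s, hA.mul_mem hb (hA.x_mem s), by rwa [mul_assoc]⟩

theorem GA.functional (hA : GA K x V d) : ∃ ε : A →ₗ[K] K, ∀ z ∈ V d, ε z = 0 → z = 0 := by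
  obtain ⟨v, hv, hv'⟩ := finrank_eq_one_iff'.1 hA.top
  have hv0 : (v : A) ≠ 0 := by simpa using hv
  have : ∃ ε : Module.Dual K A, ε v ≠ 0 := by
    by_contra! h
    exact hv0 ((Module.forall_dual_apply_eq_zero_iff K (v : A)).1 h)
  obtain ⟨ε, hε⟩ := this
  refine ⟨ε, fun z hz h => ?_⟩
  obtain ⟨c, hc⟩ := hv' ⟨z, hz⟩
  have hc' : c • (v : A) = z := congrArg Subtype.val hc
  rw [← hc', map_smul, smul_eq_mul, mul_eq_zero] at h
  rcases h with h | h
  · rw [← hc', h, zero_smul]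
  · exact absurd h hε

theorem GA.iso [Module.Finite K A] (hA : GA K x V d) {i j : ℕ} (hij : i + j = d)
    {U W : Submodule K A} (hU : U ≤ V i) (hW : W ≤ V j) (h : ∀ u ∈ U, ∀ w ∈ W, u * w = 0) :
    Module.finrank K U + Module.finrank K W ≤ Module.finrank K (V i) := by
  obtain ⟨ε, hε⟩ := hA.functional
  let U' : Submodule K (V i) := U.comap (V i).subtype
  have hU' : Module.finrank K U' = Module.finrank K U :=
    LinearEquiv.finrank_eq (Submodule.comapSubtypeEquivOfLe hU)
  have h1 := Subspace.finrank_add_finrank_dualAnnihilator_eq (K := K) (V := V i) U'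
  let f : W →ₗ[K] Module.Dual K (V i) :=
    ((LinearMap.mul K A).compr₂ ε).domRestrict₁₂ W (V i)
  have hf : ∀ w : W, ∀ u : V i, f w u = ε ((w : A) * u) := fun _ _ => rfl
  let g : W →ₗ[K] U'.dualAnnihilator := LinearMap.codRestrict _ f (fun w => by
    rw [Submodule.mem_dualAnnihilator]
    intro u hu
    have h3 : (u : A) * w = 0 := h _ hu _ w.2
    rw [hf, mul_comm, h3, map_zero])
  have h2 : Module.finrank K W ≤ Module.finrank K U'.dualAnnihilator := by
    apply LinearMap.finrank_le_finrank_of_injective (f := g)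
    refine (injective_iff_map_eq_zero g).2 ?_
    intro w hw
    by_contra hw0
    have hw0' : (w : A) ≠ 0 := by simpa using hw0
    obtain ⟨b, hb, hb'⟩ := hA.pairing (i := j) (j := i) (by omega) (hW w.2) hw0'
    apply hb'
    apply hε
    · rw [← hij]; exact hA.mul_mem hb (hW w.2)
    · have h3 : f w = 0 := congrArg Subtype.val hw
      have h4 := LinearMap.congr_fun h3 ⟨b, hb⟩
      rw [hf] at h4
      rw [mul_comm]; exact h4
  omega

theorem GA.ind (hA : GA K x V d) {j : ℕ} (f : A →ₗ[K] A) (S : Submodule K A)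
    (h : ∀ s, ∀ m ∈ V j, f (x s * m) ∈ S) : ∀ p ∈ V (j + 1), f p ∈ S := by
  intro p hp
  have : Submodule.span K {z | ∃ i, ∃ a ∈ V j, z = x i * a} ≤ S.comap f := by
    rw [Submodule.span_le]
    rintro z ⟨i, q, hq, rfl⟩
    exact h i q hq
  exact this (hA.succ_le _ hp)

theorem GA.R1_succ (hA : GA K x V d) {j : ℕ} {a : A} (h : R1 V (j + 1) a) : R1 V (j + 2) a := by
  obtain ⟨w, hw⟩ := h
  by_cases h0 : ∀ s, ∀ m ∈ V j, x s * m * a = 0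
  · refine ⟨0, fun p hp => ⟨0, ?_⟩⟩
    have h1 : ∀ q ∈ V (j + 1), q * a = 0 := fun q hq => by
      simpa using hA.ind (LinearMap.mulRight K a) ⊥ (fun s m hm => by simpa using h0 s m hm) q hq
    have := hA.ind (j := j + 1) (LinearMap.mulRight K a) ⊥
      (fun s m hm => by simp [mul_assoc, h1 m hm]) p hp
    simpa using this
  · push Not at h0
    obtain ⟨s, m, hm, hne⟩ := h0
    have hsm : x s * m ∈ V (j + 1) := by
      rw [add_comm]; exact hA.mul_mem (hA.x_mem s) hm
    obtain ⟨c0, hc0⟩ := hw _ hsm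
    have hc00 : c0 ≠ 0 := by rintro rfl; apply hne; rw [hc0, zero_smul]
    have hw' : ∀ p ∈ V (j + 1), ∃ c : K, p * a = c • (x s * m * a) := by
      intro p hp
      obtain ⟨c, hc⟩ := hw p hp
      refine ⟨c * c0⁻¹, ?_⟩
      rw [hc0, smul_smul, mul_assoc, inv_mul_cancel₀ hc00, mul_one, hc]
    refine ⟨x s * (x s * m * a), fun p hp => ?_⟩
    have := hA.ind (j := j + 1) (LinearMap.mulRight K a)
      (Submodule.span K {x s * (x s * m * a)}) (fun i q hq => by
        obtain ⟨c, hc⟩ := hw' q hq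
        have him : x i * m ∈ V (j + 1) := by
          rw [add_comm]; exact hA.mul_mem (hA.x_mem i) hm
        obtain ⟨c', hc'⟩ := hw' _ him
        refine Submodule.mem_span_singleton.2 ⟨c * c', ?_⟩
        symm
        calc x i * q * a = x i * (q * a) := by ring
          _ = c • (x s * (x i * m * a)) := by
            rw [hc, mul_smul_comm]; congr 1; ring
          _ = _ := by rw [hc', mul_smul_comm, smul_smul]) p hp
    obtain ⟨c, hc⟩ := Submodule.mem_span_singleton.1 this
    exact ⟨c, hc.symm⟩

theorem GA.R1_le (hA : GA K x V d) {i j : ℕ} {a : A} (hi : 1 ≤ i) (hij : i ≤ j)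
    (h : R1 V i a) : R1 V j a := by
  induction j, hij using Nat.le_induction with
  | base => exact h
  | succ j hj ih =>
    obtain ⟨j', rfl⟩ : ∃ j', j = j' + 1 := ⟨j - 1, by omega⟩
    exact hA.R1_succ ih

theorem GA.R1_sym (hA : GA K x V d) {k e : ℕ} {a : A} (ha : a ∈ V k) (hk : k + 1 + e = d)
    (h : R1 V e a) : R1 V 1 a := by
  obtain ⟨ε, hε⟩ := hA.functional
  obtain ⟨w, hw⟩ := h
  have key : ∀ y ∈ V 1, ε (y * w) = 0 → y * a = 0 := by
    intro y hy h0
    by_contra hne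
    obtain ⟨b, hb, hb'⟩ := hA.pairing (i := 1 + k) (j := e) (by omega) (hA.mul_mem hy ha) hne
    apply hb'
    apply hε
    · have := hA.mul_mem hb (hA.mul_mem hy ha)
      rwa [show e + (1 + k) = d by omega] at this
    · obtain ⟨c, hc⟩ := hw b hb
      have : b * (y * a) = c • (y * w) := by
        calc b * (y * a) = y * (b * a) := by ring
          _ = _ := by rw [hc, mul_smul_comm]
      rw [this, map_smul, h0, smul_zero]
  by_cases hall : ∀ y ∈ V 1, ε (y * w) = 0
  · exact ⟨0, fun y hy => ⟨0, by simp [key y hy (hall y hy)]⟩⟩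
  · push Not at hall
    obtain ⟨y0, hy0, hne⟩ := hall
    refine ⟨y0 * a, fun y hy => ⟨ε (y * w) / ε (y0 * w), ?_⟩⟩
    have h1 := key (y - (ε (y * w) / ε (y0 * w)) • y0)
      (Submodule.sub_mem _ hy (Submodule.smul_mem _ _ hy0)) (by
        rw [sub_mul, map_sub, smul_mul_assoc, map_smul, smul_eq_mul, div_mul_cancel₀ _ hne,
          sub_self])
    rw [sub_mul, smul_mul_assoc, sub_eq_zero] at h1
    exact h1

/-- In the middle range the multiples of a rank at least two element are two-dimensional. -/
theorem GA.not_R1 (hA : GA K x V d) {k j : ℕ} {a : A} (ha : a ∈ V k) (hj : 1 ≤ j)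
    (hk : k + j + 1 ≤ d) (h : ¬ R1 V 1 a) : ¬ R1 V j a := by
  intro h'
  exact h (hA.R1_sym ha (e := d - k - 1) (by omega) (hA.R1_le hj (by omega) h'))

end Abstract2



section Abstract3

variable {K : Type*} [Field K] {n : ℕ} {A : Type*} [CommRing A] [Algebra K A]
variable {x : Fin n → A} {V : ℕ → Submodule K A} {d : ℕ}

theorem GA.gen_ne (hA : GA K x V d) {k : ℕ} (hk : k < d) {a : A} (ha : a ∈ V k) (h0 : a ≠ 0) :
    Gen (fun t : Fin n → K => lin x t * a ≠ 0) := by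
  obtain ⟨s, hs⟩ := hA.nz hk ha h0
  have : ∃ ε : Module.Dual K A, ε (x s * a) ≠ 0 := by
    by_contra! h
    exact hs ((Module.forall_dual_apply_eq_zero_iff K _).1 h)
  obtain ⟨ε, hε⟩ := this
  refine ⟨∑ j, C (ε (x j * a)) * X j, ?_, fun t ht h => ht ?_⟩
  · intro h
    apply hε
    have h1 := congrArg (eval (Pi.single s (1 : K))) h
    simpa [Pi.single_apply] using h1
  · have h1 := congrArg ε h
    rw [lin, Finset.sum_mul, map_sum, map_zero] at h1
    simp only [map_sum, map_mul, eval_C, eval_X]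
    rw [← h1]
    refine Finset.sum_congr rfl fun j _ => ?_
    rw [smul_mul_assoc, map_smul, smul_eq_mul, mul_comm]

theorem GA.R1_mul_ne (hA : GA K x V d) {a y q : A} {i : ℕ} (hr : R1 V 1 a) (hy : y ∈ V 1)
    (hya : y * a ≠ 0) (hi : i < d) (hq : q * a ∈ V i) (hq0 : q * a ≠ 0) : y * q * a ≠ 0 := by
  obtain ⟨w, hw⟩ := hr
  obtain ⟨s, hs⟩ := hA.nz hi hq hq0
  obtain ⟨c, hc⟩ := hw _ (hA.x_mem s)
  obtain ⟨c', hc'⟩ := hw _ hy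
  have hc0 : c' ≠ 0 := by rintro rfl; apply hya; rw [hc', zero_smul]
  intro h
  apply hs
  have h1 : x s * a = (c * c'⁻¹) • (y * a) := by
    rw [hc', smul_smul, mul_assoc, inv_mul_cancel₀ hc0, mul_one, hc]
  calc x s * (q * a) = q * (x s * a) := by ring
    _ = (c * c'⁻¹) • (y * q * a) := by rw [h1, mul_smul_comm]; congr 1; ring
    _ = 0 := by rw [h, smul_zero]

theorem GA.R1_prod_ne (hA : GA K x V d) {a q : A} {i : ℕ} (hr : R1 V 1 a) {ι : Type*}
    (s : Finset ι) (y : ι → A) (hy : ∀ j ∈ s, y j ∈ V 1) (hya : ∀ j ∈ s, y j * a ≠ 0)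
    (hi : i + s.card ≤ d) (hq : q * a ∈ V i) (hq0 : q * a ≠ 0) :
    (∏ j ∈ s, y j) * q * a ≠ 0 ∧ (∏ j ∈ s, y j) * q * a ∈ V (i + s.card) := by
  classical
  induction s using Finset.induction_on with
  | empty => simpa using ⟨hq0, hq⟩
  | insert b s hb ih =>
    rw [Finset.card_insert_of_notMem hb] at hi ⊢
    obtain ⟨h1, h2⟩ := ih (fun j hj => hy j (by simp [hj])) (fun j hj => hya j (by simp [hj]))
      (by omega)
    rw [Finset.prod_insert hb, mul_assoc (y b)]
    refine ⟨hA.R1_mul_ne hr (hy b (by simp)) (hya b (by simp)) (by omega) h2 h1, ?_⟩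
    have := hA.mul_mem (hy b (by simp)) h2
    rwa [show 1 + (i + s.card) = i + (s.card + 1) by omega, ← mul_assoc] at this

theorem GA.indep (hA : GA K x V d) {k s : ℕ} (a z : ℕ → A) (y : ℕ → ℕ → A)
    (ha : ∀ i, a i ∈ V k) (hr : ∀ i, R1 V 1 (a i)) (h0 : ∀ i, a i ≠ 0)
    (hz : ∀ i, z i ∈ V 1) (hza : ∀ i, z i * a i ≠ 0)
    (hy : ∀ i j, i ≠ j → y i j ∈ V 1 ∧ y i j * a i = 0 ∧ y i j * a j ≠ 0)
    (S : Finset ℕ) (hS : k + s + S.card ≤ d + 1) (hks : k + s ≤ d) :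
    Module.finrank K (Submodule.span K ((fun i => z i ^ s * a i) '' (S : Set ℕ))) = S.card := by
  classical
  have hzs : ∀ i, z i ^ s * a i ≠ 0 ∧ z i ^ s * a i ∈ V (k + s) := by
    intro i
    have := hA.R1_prod_ne (i := k) (q := 1) (hr i) (Finset.range s) (fun _ => z i)
      (fun _ _ => hz i) (fun _ _ => hza i) (by simpa using hks) (by simpa using ha i)
      (by simpa using h0 i)
    simpa using this
  have hli : LinearIndependent K (fun i : S => z i ^ s * a i) := by
    rw [Fintype.linearIndependent_iff]
    intro g hg i0
    have h1 : ((∏ j ∈ S.erase i0, y j i0) * z i0 ^ s) * a i0 ≠ 0 :=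
      (hA.R1_prod_ne (i := k + s) (q := z i0 ^ s) (hr i0) (S.erase i0) (fun j => y j i0)
      (fun j hj => (hy j i0 (Finset.ne_of_mem_erase hj)).1)
      (fun j hj => (hy j i0 (Finset.ne_of_mem_erase hj)).2.2)
      (by rw [Finset.card_erase_of_mem i0.2]; omega) (hzs i0).2 (hzs i0).1).1
    have h2 := congrArg (fun u => (∏ j ∈ S.erase i0, y j i0) * u) hg
    simp only [mul_zero, Finset.mul_sum] at h2
    rw [Finset.sum_eq_single i0] at h2
    · rw [mul_smul_comm, ← mul_assoc] at h2
      exact (smul_eq_zero.1 h2).resolve_right h1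
    · intro b _ hb
      have hb' : (b : ℕ) ∈ S.erase i0 := Finset.mem_erase.2 ⟨fun h => hb (Subtype.ext h), b.2⟩
      rw [← Finset.mul_prod_erase _ _ hb', mul_smul_comm]
      have := (hy b i0 (Finset.ne_of_mem_erase hb')).2.1
      rw [show y b i0 * (∏ j ∈ (S.erase i0).erase b, y j i0) * (z b ^ s * a b)
        = (∏ j ∈ (S.erase i0).erase b, y j i0) * z b ^ s * (y b i0 * a b) by ring, this]
      simp
    · simp
  have := finrank_span_eq_card hli
  rw [Fintype.card_coe] at this
  have hset : Set.range (fun i : S => z i ^ s * a i) = (fun i => z i ^ s * a i) '' (S : Set ℕ) := by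
    ext u; simp
  rw [hset] at this
  exact this

theorem GA.rank_one_case [Module.Finite K A] (hA : GA K x V d) {k : ℕ} (hk : 2 * k < d)
    (h : ¬ Gen (fun t : Fin n → K => ∀ a ∈ V k, a ≠ 0 → lin x t * a = 0 → ¬ R1 V 1 a))
    (i : ℕ) (hi : k ≤ i) (hi' : i + k ≤ d) : d + 2 ≤ Module.finrank K (V i) := by
  classical
  have hseq := exists_seq_of_forall_finset_exists
    (fun p : (Fin n → K) × A => p.2 ∈ V k ∧ p.2 ≠ 0 ∧ lin x p.1 * p.2 = 0 ∧ R1 V 1 p.2)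
    (fun p q => lin x q.1 * p.2 ≠ 0) (by
      intro s hs
      have hg : Gen (fun t : Fin n → K => ∀ p ∈ s, lin x t * p.2 ≠ 0) :=
        Gen.forall_finset s (fun p hp => hA.gen_ne (by omega) (hs p hp).1 (hs p hp).2.1)
      by_contra! hcon
      apply h
      refine hg.mono fun t ht a ha ha0 hl hr => ?_
      obtain ⟨p, hp, hp'⟩ := hcon (t, a) ⟨ha, ha0, hl, hr⟩
      exact ht p hp hp')
  obtain ⟨f, hf, hff⟩ := hseq
  let a : ℕ → A := fun i => (f i).2
  have ha : ∀ i, a i ∈ V k := fun i => (hf i).1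
  have h0 : ∀ i, a i ≠ 0 := fun i => (hf i).2.1
  have hr : ∀ i, R1 V 1 (a i) := fun i => (hf i).2.2.2
  have hzex : ∀ i, ∃ s, x s * a i ≠ 0 := fun i => hA.nz (by omega) (ha i) (h0 i)
  choose zs hzs using hzex
  have hyex : ∀ i j, ∃ y, i ≠ j → y ∈ V 1 ∧ y * a i = 0 ∧ y * a j ≠ 0 := by
    intro i j
    rcases lt_trichotomy i j with hij | hij | hij
    · -- `lin (f j)` kills `a j` and not `a i`
      obtain ⟨w, hw⟩ := hr i
      obtain ⟨c, hc⟩ := hw _ (hA.x_mem (zs j))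
      obtain ⟨c', hc'⟩ := hw _ (lin_mem hA (f j).1)
      have h1 : lin x (f j).1 * a i ≠ 0 := hff i j hij
      have hc0 : c' ≠ 0 := by rintro rfl; apply h1; rw [hc', zero_smul]
      refine ⟨x (zs j) - (c * c'⁻¹) • lin x (f j).1, fun _ => ⟨?_, ?_, ?_⟩⟩
      · exact Submodule.sub_mem _ (hA.x_mem _) (Submodule.smul_mem _ _ (lin_mem hA _))
      · rw [sub_mul, smul_mul_assoc, hc, hc', smul_smul, mul_assoc, inv_mul_cancel₀ hc0, mul_one,
          sub_self]
      · have h2 : lin x (f j).1 * a j = 0 := (hf j).2.2.1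
        rw [sub_mul, smul_mul_assoc, h2, smul_zero, sub_zero]
        exact hzs j
    · exact ⟨0, fun h => absurd hij h⟩
    · exact ⟨lin x (f i).1, fun _ => ⟨lin_mem hA _, (hf i).2.2.1, hff j i hij⟩⟩
  choose y hy using hyex
  have hcross : ∀ i j, i ≠ j → ∀ z ∈ V 1, z * (a i * a j) = 0 := by
    intro i j hij z hz
    obtain ⟨h1, h2, h3⟩ := hy i j hij
    obtain ⟨w, hw⟩ := hr j
    obtain ⟨c, hc⟩ := hw _ hz
    obtain ⟨c', hc'⟩ := hw _ h1
    have hc0 : c' ≠ 0 := by rintro rfl; apply h3; rw [hc', zero_smul]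
    have h4 : z * a j = (c * c'⁻¹) • (y i j * a j) := by
      rw [hc', smul_smul, mul_assoc, inv_mul_cancel₀ hc0, mul_one, hc]
    calc z * (a i * a j) = a i * (z * a j) := by ring
      _ = (c * c'⁻¹) • ((y i j * a i) * a j) := by rw [h4, mul_smul_comm]; congr 1; ring
      _ = 0 := by rw [h2, zero_mul, smul_zero]
  obtain ⟨s, rfl⟩ : ∃ s, i = k + s := ⟨i - k, by omega⟩
  obtain ⟨s', hs'⟩ : ∃ s', k + s + (k + s') = d := ⟨d - (k + s) - k, by omega⟩
  let S1 := Finset.range (d + 1 - (k + s))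
  let S2 := Finset.Ico (d + 1) (d + 1 + (d + 1 - (k + s')))
  have e1 := hA.indep (s := s) a (fun i => x (zs i)) y ha hr h0 (fun i => hA.x_mem _) hzs
    (fun i j hij => hy i j hij) S1 (by simp only [S1, Finset.card_range]; omega) (by omega)
  have e2 := hA.indep (s := s') a (fun i => x (zs i)) y ha hr h0 (fun i => hA.x_mem _) hzs
    (fun i j hij => hy i j hij) S2 (by simp only [S2, Nat.card_Ico]; omega) (by omega)
  have hpow : ∀ (z : A) (r : ℕ), z ∈ V 1 → z ^ r ∈ V r := by
    intro z r hz
    induction r with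
    | zero => simpa using hA.one_mem
    | succ r ih => rw [pow_succ]; exact hA.mul_mem ih hz
  have e3 := hA.iso hs'
    (U := Submodule.span K ((fun i => x (zs i) ^ s * a i) '' (S1 : Set ℕ)))
    (W := Submodule.span K ((fun i => x (zs i) ^ s' * a i) '' (S2 : Set ℕ)))
    (by
      rw [Submodule.span_le]
      rintro _ ⟨i, _, rfl⟩
      have := hA.mul_mem (hpow _ s (hA.x_mem (zs i))) (ha i)
      rwa [add_comm] at this)
    (by
      rw [Submodule.span_le]
      rintro _ ⟨i, _, rfl⟩
      have := hA.mul_mem (hpow _ s' (hA.x_mem (zs i))) (ha i)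
      rwa [add_comm] at this)
    (by
      intro u hu w hw
      induction hu using Submodule.span_induction with
      | zero => simp
      | add u v _ _ h1 h2 => rw [add_mul, h1, h2, add_zero]
      | smul c u _ h1 => rw [smul_mul_assoc, h1, smul_zero]
      | mem u hu =>
        induction hw using Submodule.span_induction with
        | zero => simp
        | add u v _ _ h1 h2 => rw [mul_add, h1, h2, add_zero]
        | smul c u _ h1 => rw [mul_smul_comm, h1, smul_zero]
        | mem w hw =>
          obtain ⟨i, hi1, rfl⟩ := hu
          obtain ⟨j, hj1, rfl⟩ := hw
          have hij : i ≠ j := by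
            simp only [S1, S2, Finset.coe_range, Finset.coe_Ico, Set.mem_Iio, Set.mem_Ico] at hi1 hj1
            omega
          change x (zs i) ^ s * a i * (x (zs j) ^ s' * a j) = 0
          rcases Nat.eq_zero_or_pos s with rfl | hs
          · obtain ⟨r, rfl⟩ : ∃ r, s' = r + 1 := ⟨s' - 1, by omega⟩
            calc _ = x (zs j) ^ r * (x (zs j) * (a i * a j)) := by ring
              _ = 0 := by rw [hcross i j hij _ (hA.x_mem _), mul_zero]
          · obtain ⟨r, rfl⟩ : ∃ r, s = r + 1 := ⟨s - 1, by omega⟩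
            calc _ = x (zs i) ^ r * x (zs j) ^ s' * (x (zs i) * (a i * a j)) := by ring
              _ = 0 := by rw [hcross i j hij _ (hA.x_mem _), mul_zero])
  rw [e1, e2] at e3
  simp only [S1, S2, Finset.card_range, Nat.card_Ico] at e3
  omega

end Abstract3



section Abstract4

variable {K : Type*} [Field K] {n : ℕ} {A : Type*} [CommRing A] [Algebra K A]
variable {x : Fin n → A} {V : ℕ → Submodule K A} {d : ℕ}

/-- The generic linear form. -/
noncomputable def LL (x : Fin n → A) : MvPolynomial (Fin n) A := ∑ j, C (x j) * X j

theorem ev_LL (t : Fin n → K) : ev A t (LL x) = lin x t := by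
  simp [LL, lin, ev, Algebra.smul_def, mul_comm]

theorem pderiv_LL (i : Fin n) : pderiv i (LL x) = C (x i) := by
  classical
  simp [LL, pderiv_X, Pi.single_apply]

theorem coeff_pderiv_mem (U : Submodule K A) (P : MvPolynomial (Fin n) A) (i : Fin n)
    (hP : ∀ m, coeff m P ∈ U) : ∀ m, coeff m (pderiv i P) ∈ U := by
  classical
  intro m
  rw [P.as_sum, map_sum, coeff_sum]
  refine Submodule.sum_mem _ fun s _ => ?_
  rw [pderiv_monomial, coeff_monomial]
  split_ifs
  · rw [mul_comm, ← nsmul_eq_mul]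
    exact U.smul_of_tower_mem _ (hP s)
  · exact U.zero_mem

theorem LL_jet1 {P : MvPolynomial (Fin n) A} (h : LL x * P = 0) (i : Fin n) :
    LL x * pderiv i P = - (C (x i) * P) := by
  have := congrArg (pderiv i) h
  rw [Derivation.leibniz, pderiv_LL, map_zero] at this
  simp only [smul_eq_mul] at this
  linear_combination this

theorem LL_jet2 {P : MvPolynomial (Fin n) A} (h : LL x * P = 0) (i j : Fin n) :
    LL x * pderiv j (pderiv i P) = - (C (x i) * pderiv j P) - C (x j) * pderiv i P := by
  have := congrArg (pderiv j) (LL_jet1 h i)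
  rw [map_neg, Derivation.leibniz, Derivation.leibniz, pderiv_LL, pderiv_C] at this
  simp only [smul_eq_mul] at this
  linear_combination this

theorem LL_jet3 {P : MvPolynomial (Fin n) A} (h : LL x * P = 0) (i j l : Fin n) :
    LL x * pderiv l (pderiv j (pderiv i P)) = - (C (x i) * pderiv l (pderiv j P))
      - C (x j) * pderiv l (pderiv i P) - C (x l) * pderiv j (pderiv i P) := by
  have := congrArg (pderiv l) (LL_jet2 h i j)
  rw [map_sub, map_neg, Derivation.leibniz, Derivation.leibniz, Derivation.leibniz, pderiv_LL,
    pderiv_C, pderiv_C] at this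
  simp only [smul_eq_mul] at this
  linear_combination this

theorem jets (U : Submodule K A) (t : Fin n → K) {P : MvPolynomial (Fin n) A}
    (hP : ∀ m, coeff m P ∈ U) (h : LL x * P = 0) :
    ∃ (a1 : Fin n → A) (a2 : Fin n → Fin n → A) (a3 : Fin n → Fin n → Fin n → A),
      (∀ i, a1 i ∈ U) ∧ (∀ i j, a2 i j ∈ U) ∧ (∀ i j l, a3 i j l ∈ U) ∧
      (∀ i, a1 i = ev A t (pderiv i P)) ∧
      (∀ i, lin x t * a1 i = - (x i * ev A t P)) ∧
      (∀ i j, lin x t ^ 2 * a2 i j = 2 * (x i * x j * ev A t P)) ∧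
      (∀ i j l, lin x t ^ 3 * a3 i j l = - 6 * (x i * x j * x l * ev A t P)) := by
  refine ⟨fun i => ev A t (pderiv i P), fun i j => ev A t (pderiv j (pderiv i P)),
    fun i j l => ev A t (pderiv l (pderiv j (pderiv i P))), ?_, ?_, ?_, fun _ => rfl, ?_, ?_, ?_⟩
  · exact fun i => ev_mem t U _ (coeff_pderiv_mem U _ _ hP)
  · exact fun i j => ev_mem t U _ (coeff_pderiv_mem U _ _ (coeff_pderiv_mem U _ _ hP))
  · exact fun i j l => ev_mem t U _
      (coeff_pderiv_mem U _ _ (coeff_pderiv_mem U _ _ (coeff_pderiv_mem U _ _ hP)))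
  all_goals
    have e1 : ∀ i, lin x t * ev A t (pderiv i P) = - (x i * ev A t P) := fun i => by
      have := congrArg (ev A t) (LL_jet1 h i)
      simpa only [map_mul, map_neg, ev_C, ev_LL] using this
    have e2 : ∀ i j, lin x t * ev A t (pderiv j (pderiv i P)) =
        - (x i * ev A t (pderiv j P)) - x j * ev A t (pderiv i P) := fun i j => by
      have := congrArg (ev A t) (LL_jet2 h i j)
      simpa only [map_mul, map_neg, map_sub, ev_C, ev_LL] using this
    have e3 : ∀ i j l, lin x t * ev A t (pderiv l (pderiv j (pderiv i P))) =
        - (x i * ev A t (pderiv l (pderiv j P))) - x j * ev A t (pderiv l (pderiv i P))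
          - x l * ev A t (pderiv j (pderiv i P)) := fun i j l => by
      have := congrArg (ev A t) (LL_jet3 h i j l)
      simpa only [map_mul, map_neg, map_sub, ev_C, ev_LL] using this
  · exact e1
  · intro i j
    linear_combination lin x t * e2 i j - x i * e1 j - x j * e1 i
  · intro i j l
    linear_combination lin x t ^ 2 * e3 i j l - x i * lin x t * e2 j l - x j * lin x t * e2 i l
      - x l * lin x t * e2 i j + 2 * x i * x j * e1 l + 2 * x i * x l * e1 j + 2 * x j * x l * e1 i

theorem GA.prod_zero (hA : GA K x V d) {k : ℕ} (hk : 2 * k < d) {P Q : MvPolynomial (Fin n) A}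
    (hP : ∀ m, coeff m P ∈ V k) (hQ : ∀ m, coeff m Q ∈ V k) (h : LL x * P = 0)
    (h' : LL x * Q = 0) : P * Q = 0 := by
  classical
  have h1 : ∀ j, C (x j) * (P * Q) = 0 := fun j => by
    linear_combination Q * LL_jet1 h j - pderiv j P * h'
  ext m
  rw [coeff_zero]
  refine hA.nd (i := k + k) (by omega) ?_ fun j => ?_
  · rw [coeff_mul]
    exact Submodule.sum_mem _ fun p _ => hA.mul_mem (hP _) (hQ _)
  · rw [← coeff_C_mul, h1, coeff_zero]

theorem gen_ev_ne [Module.Finite K A] {Q : MvPolynomial (Fin n) A} (hQ : Q ≠ 0) :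
    Gen (fun t : Fin n → K => ev A t Q ≠ 0) := by
  let b := Module.finBasis K A
  obtain ⟨c, hc⟩ := exists_repr b Q
  have : ∃ i, c i ≠ 0 := by
    by_contra! h
    apply hQ
    rw [hc]; simp [h]
  obtain ⟨i, hi⟩ := this
  refine ⟨c i, hi, fun t ht h0 => ht ?_⟩
  rw [hc, map_sum] at h0
  simp only [map_mul, ev_map, ev_C, ← Algebra.smul_def] at h0
  exact Fintype.linearIndependent_iff.1 b.linearIndependent _ h0 i

theorem GA.pow_aux [CharZero K] (hA : GA K x V d) (e : ℕ) : ∀ m : A, C m * LL x ^ e = 0 →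
    ∀ p ∈ V e, p * m = 0 := by
  induction e with
  | zero =>
    intro m h p _
    have : m = 0 := by simpa using h
    rw [this, mul_zero]
  | succ e ih =>
    intro m h p hp
    have := hA.ind (j := e) (LinearMap.mulRight K m) ⊥ (fun s q hq => ?_) p hp
    · simpa using this
    · have h1 := congrArg (pderiv s) h
      rw [Derivation.leibniz, Derivation.leibniz_pow, pderiv_C, pderiv_LL] at h1
      simp only [smul_eq_mul, mul_zero, add_zero, map_zero, Nat.add_sub_cancel] at h1
      have h2 : C (((e : A) + 1) * (m * x s)) * LL x ^ e = 0 := by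
        simp only [map_mul, map_add, map_natCast, map_one]
        rw [nsmul_eq_mul] at h1
        push_cast at h1
        linear_combination h1
      have h3 := ih _ h2 q hq
      have h4 : ((e : K) + 1) • (q * (m * x s)) = 0 := by
        rw [Algebra.smul_def]
        simp only [map_add, map_natCast, map_one]
        linear_combination h3
      have h5 := (smul_eq_zero.1 h4).resolve_left (Nat.cast_add_one_ne_zero e)
      simp only [LinearMap.mulRight_apply, Submodule.mem_bot]
      linear_combination h5

theorem GA.gen_pow [CharZero K] [Module.Finite K A] (hA : GA K x V d) :
    Gen (fun t : Fin n → K => lin x t ^ d ≠ 0) := by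
  have h : LL x ^ d ≠ 0 := by
    intro h
    obtain ⟨v, hv, _⟩ := finrank_eq_one_iff'.1 hA.top
    have := hA.pow_aux d 1 (by simpa using h) v v.2
    exact hv (by simpa using this)
  refine (gen_ev_ne (K := K) h).mono fun t ht => ?_
  rwa [map_pow, ev_LL] at ht

theorem GA.MulS_zero (hA : GA K x V d) {a : A} {S : Submodule K A} (h : a ∈ S) :
    MulS V 0 a ≤ S := by
  intro z hz
  obtain ⟨p, hp, rfl⟩ := mem_MulS.1 hz
  obtain ⟨c, rfl⟩ := Submodule.mem_span_singleton.1 (hA.zero_le hp)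
  simpa using S.smul_mem c h

theorem GA.MulS_succ (hA : GA K x V d) {j : ℕ} {a : A} {S : Submodule K A}
    (h : ∀ s, MulS V j (x s * a) ≤ S) : MulS V (j + 1) a ≤ S := by
  intro z hz
  obtain ⟨p, hp, rfl⟩ := mem_MulS.1 hz
  refine hA.ind (LinearMap.mulRight K a) S (fun s m hm => h s (mem_MulS.2 ⟨m, hm, ?_⟩)) p hp
  simp only [LinearMap.mulRight_apply]; ring

theorem GA.case_ge [CharZero K] [Module.Finite K A] (hA : GA K x V d) {k : ℕ} (hk : k + 4 ≤ d)
    (t : Fin n → K) {P : MvPolynomial (Fin n) A} (hP : ∀ m, coeff m P ∈ V k) (h : LL x * P = 0)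
    (hR : ¬ R1 V 1 (ev A t P)) : 7 ≤ Module.finrank K (V k) := by
  obtain ⟨a1, a2, a3, m1, m2, m3, -, e1, e2, e3⟩ := jets (V k) t hP h
  have ha : ev A t P ∈ V k := ev_mem t _ _ hP
  have hl : lin x t * ev A t P = 0 := by
    have := congrArg (ev A t) h
    simpa only [map_mul, map_zero, ev_LL] using this
  generalize ev A t P = a at *
  set l := lin x t
  have ha0 : a ≠ 0 := by
    rintro rfl
    exact hR ⟨0, fun p _ => ⟨0, by simp⟩⟩
  have h6 : (6 : K) ≠ 0 := by norm_num
  have h2 : (2 : K) ≠ 0 := by norm_num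
  let E0 := Submodule.span K {a}
  let E1 := Submodule.span K (Set.range a1)
  let E2 := Submodule.span K (Set.range fun p : Fin n × Fin n => a2 p.1 p.2)
  let E3 := Submodule.span K (Set.range fun p : Fin n × Fin n × Fin n => a3 p.1 p.2.1 p.2.2)
  have f0 : Module.finrank K E0 = 1 := finrank_span_singleton ha0
  have g1 : MulS V 1 a ≤ E1.map (LinearMap.mulLeft K l) := by
    refine hA.MulS_succ fun s => hA.MulS_zero ?_
    refine ⟨- a1 s, Submodule.neg_mem _ (Submodule.subset_span ⟨s, rfl⟩), ?_⟩
    simp [e1]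
  have g2 : MulS V 2 a ≤ E2.map (LinearMap.mulLeft K (l ^ 2)) := by
    refine hA.MulS_succ fun s => hA.MulS_succ fun u => hA.MulS_zero ?_
    refine ⟨(2 : K)⁻¹ • a2 s u, Submodule.smul_mem _ _ (Submodule.subset_span ⟨(s, u), rfl⟩), ?_⟩
    rw [map_smul, LinearMap.mulLeft_apply, e2, show (2 : A) * (x s * x u * a)
      = (2 : K) • (x s * x u * a) by simp [Algebra.smul_def, map_ofNat], smul_smul, inv_mul_cancel₀ h2, one_smul]
    ring
  have g3 : MulS V 3 a ≤ E3.map (LinearMap.mulLeft K (l ^ 3)) := by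
    refine hA.MulS_succ fun s => hA.MulS_succ fun u => hA.MulS_succ fun w => hA.MulS_zero ?_
    refine ⟨(-(6 : K)⁻¹) • a3 s u w,
      Submodule.smul_mem _ _ (Submodule.subset_span ⟨(s, u, w), rfl⟩), ?_⟩
    rw [map_smul, LinearMap.mulLeft_apply, e3, show (-6 : A) * (x s * x u * x w * a)
      = (-6 : K) • (x s * x u * x w * a) by simp [Algebra.smul_def, map_ofNat], smul_smul]
    rw [show -(6 : K)⁻¹ * -6 = 1 by field_simp, one_smul]
    ring
  have r1 := two_le_of_not_R1 hR
  have r2 := two_le_of_not_R1 (hA.not_R1 ha (j := 2) (by omega) (by omega) hR)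
  have r3 := two_le_of_not_R1 (hA.not_R1 ha (j := 3) (by omega) (by omega) hR)
  have s1 := finrank_sup_ge E0 E1 (LinearMap.mulLeft K l) (by
    simp only [E0]
    rw [Submodule.span_le]
    rintro z rfl
    simpa using hl)
  have s2 := finrank_sup_ge (E0 ⊔ E1) E2 (LinearMap.mulLeft K (l ^ 2)) (by
    refine sup_le (Submodule.span_le.2 ?_) (Submodule.span_le.2 ?_)
    · rintro z rfl
      show l ^ 2 * z = 0
      linear_combination l * hl
    · rintro z ⟨i, rfl⟩
      show l ^ 2 * a1 i = 0
      linear_combination l * e1 i - x i * hl)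
  have s3 := finrank_sup_ge (E0 ⊔ E1 ⊔ E2) E3 (LinearMap.mulLeft K (l ^ 3)) (by
    refine sup_le (sup_le (Submodule.span_le.2 ?_) (Submodule.span_le.2 ?_))
      (Submodule.span_le.2 ?_)
    · rintro z rfl
      show l ^ 3 * z = 0
      linear_combination l ^ 2 * hl
    · rintro z ⟨i, rfl⟩
      show l ^ 3 * a1 i = 0
      linear_combination l ^ 2 * e1 i - l * x i * hl
    · rintro z ⟨⟨i, j⟩, rfl⟩
      show l ^ 3 * a2 i j = 0
      linear_combination l * e2 i j + 2 * x i * x j * hl)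
  have t1 := Submodule.finrank_mono g1
  have t2 := Submodule.finrank_mono g2
  have t3 := Submodule.finrank_mono g3
  have t4 : Module.finrank K (E0 ⊔ E1 ⊔ E2 ⊔ E3 : Submodule K A) ≤ Module.finrank K (V k) := by
    refine Submodule.finrank_mono (sup_le (sup_le (sup_le ?_ ?_) ?_) ?_)
    · exact Submodule.span_le.2 (by rintro z rfl; exact ha)
    · exact Submodule.span_le.2 (by rintro z ⟨i, rfl⟩; exact m1 i)
    · exact Submodule.span_le.2 (by rintro z ⟨i, rfl⟩; exact m2 _ _)
    · exact Submodule.span_le.2 (by rintro z ⟨i, rfl⟩; exact m3 _ _ _)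
  omega

end Abstract4



section Abstract5

variable {K : Type*} [Field K] {n : ℕ} {A : Type*} [CommRing A] [Algebra K A]
variable {x : Fin n → A} {V : ℕ → Submodule K A} {d : ℕ}

theorem GA.setup [CharZero K] [Module.Finite K A] (hA : GA K x V d) {k : ℕ} (hk : 2 * k < d)
    (t : Fin n → K)
    (hL : ∀ a ∈ V k, lin x t * a = 0 →
      ∃ P : MvPolynomial (Fin n) A, (∀ m, coeff m P ∈ V k) ∧ LL x * P = 0 ∧ ev A t P = a)
    {a : A} (ha : a ∈ V k) (hla : lin x t * a = 0) :
    ∃ S : Submodule K A, S ≤ V k ∧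
      Module.finrank K (V k ⊓ LinearMap.ker (LinearMap.mulLeft K (lin x t)) : Submodule K A)
        + Module.finrank K (MulS V 1 a) ≤ Module.finrank K S ∧
      (∀ s ∈ S, s * a = 0) ∧ (∀ s ∈ S, lin x t ^ 2 * s = 0) := by
  obtain ⟨P, hP, hLP, hPa⟩ := hL a ha hla
  obtain ⟨a1, a2, a3, m1, m2, m3, e0, e1, -, -⟩ := jets (V k) t hP hLP
  rw [hPa] at e1
  have h2 : (2 : K) ≠ 0 := by norm_num
  let Ker := V k ⊓ LinearMap.ker (LinearMap.mulLeft K (lin x t))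
  let E1 := Submodule.span K (Set.range a1)
  have g1 : MulS V 1 a ≤ E1.map (LinearMap.mulLeft K (lin x t)) := by
    refine hA.MulS_succ fun s => hA.MulS_zero ?_
    refine ⟨- a1 s, Submodule.neg_mem _ (Submodule.subset_span ⟨s, rfl⟩), ?_⟩
    simp [e1]
  refine ⟨Ker ⊔ E1, ?_, ?_, ?_, ?_⟩
  · refine sup_le inf_le_left (Submodule.span_le.2 ?_)
    rintro z ⟨i, rfl⟩; exact m1 i
  · exact (Nat.add_le_add_left (Submodule.finrank_mono g1) _).trans
      (finrank_sup_ge Ker E1 _ inf_le_right)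
  · have : Ker ⊔ E1 ≤ LinearMap.ker (LinearMap.mulRight K a) := by
      refine sup_le ?_ (Submodule.span_le.2 ?_)
      · rintro b ⟨hb, hb'⟩
        obtain ⟨Q, hQ, hLQ, hQb⟩ := hL b hb (by simpa using hb')
        have := congrArg (ev A t) (hA.prod_zero hk hQ hP hLQ hLP)
        rw [map_mul, hQb, hPa, map_zero] at this
        simpa using this
      · rintro z ⟨i, rfl⟩
        have h1 := congrArg (pderiv i) (hA.prod_zero hk hP hP hLP hLP)
        rw [Derivation.leibniz, map_zero] at h1
        have h3 := congrArg (ev A t) h1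
        simp only [smul_eq_mul, map_add, map_mul, map_zero, hPa, ← e0] at h3
        have h4 : (2 : K) • (a1 i * a) = 0 := by
          rw [two_smul]; linear_combination h3
        simpa using (smul_eq_zero.1 h4).resolve_left h2
    intro s hs
    simpa using this hs
  · have : Ker ⊔ E1 ≤ LinearMap.ker (LinearMap.mulLeft K (lin x t ^ 2)) := by
      refine sup_le ?_ (Submodule.span_le.2 ?_)
      · rintro b ⟨hb, hb'⟩
        have hb'' : lin x t * b = 0 := by simpa using hb'
        show lin x t ^ 2 * b = 0
        linear_combination lin x t * hb''
      · rintro z ⟨i, rfl⟩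
        show lin x t ^ 2 * a1 i = 0
        linear_combination lin x t * e1 i - x i * hla
    intro s hs
    simpa using this hs

theorem R1_zero {j : ℕ} : R1 V j (0 : A) := ⟨0, fun p _ => ⟨0, by simp⟩⟩

theorem one_le_ker [Module.Finite K A] {k : ℕ} {l a : A} (ha : a ∈ V k) (h0 : a ≠ 0)
    (hl : l * a = 0) :
    1 ≤ Module.finrank K (V k ⊓ LinearMap.ker (LinearMap.mulLeft K l) : Submodule K A) := by
  rw [Nat.one_le_iff_ne_zero]
  intro h
  rw [Submodule.finrank_eq_zero] at h
  have : a ∈ (V k ⊓ LinearMap.ker (LinearMap.mulLeft K l) : Submodule K A) := ⟨ha, by simpa using hl⟩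
  rw [h] at this
  exact h0 (by simpa using this)

theorem GA.case3 [CharZero K] [Module.Finite K A] (hA : GA K x V d) (hd : 2 < d)
    (t : Fin n → K)
    (hL : ∀ a ∈ V 1, lin x t * a = 0 →
      ∃ P : MvPolynomial (Fin n) A, (∀ m, coeff m P ∈ V 1) ∧ LL x * P = 0 ∧ ev A t P = a)
    {a : A} (ha : a ∈ V 1) (hla : lin x t * a = 0) (hR : ¬ R1 V 1 a) :
    5 ≤ Module.finrank K (V 1) := by
  obtain ⟨S, hS, h1, h2, h3⟩ := hA.setup (by omega) t hL ha hla
  have h0 : a ≠ 0 := by rintro rfl; exact hR R1_zero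
  have hk := one_le_ker ha h0 hla
  have hr := two_le_of_not_R1 hR
  have h4 := finrank_map_add (V 1) (LinearMap.mulRight K a)
  have h5 : S ≤ V 1 ⊓ LinearMap.ker (LinearMap.mulRight K a) :=
    fun s hs => ⟨hS hs, by simpa using h2 s hs⟩
  have h6 := Submodule.finrank_mono h5
  change Module.finrank K (MulS V 1 a) + _ = _ at h4
  omega

theorem GA.case4 [CharZero K] [Module.Finite K A] (hA : GA K x V 4)
    (t : Fin n → K)
    (hL : ∀ a ∈ V 1, lin x t * a = 0 →
      ∃ P : MvPolynomial (Fin n) A, (∀ m, coeff m P ∈ V 1) ∧ LL x * P = 0 ∧ ev A t P = a)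
    (hp : lin x t ^ 4 ≠ 0)
    {a : A} (ha : a ∈ V 1) (hla : lin x t * a = 0) (hR : ¬ R1 V 1 a)
    (h6 : Module.finrank K (V 1) ≤ 6) :
    Module.finrank K (V 1) = 6 ∧ 6 ≤ Module.finrank K (V 2) := by
  obtain ⟨S, hS, h1, h2, h3⟩ := hA.setup (by omega) t hL ha hla
  have h0 : a ≠ 0 := by rintro rfl; exact hR R1_zero
  have hk := one_le_ker ha h0 hla
  have hr := two_le_of_not_R1 hR
  have h4 := finrank_map_add (V 1) (LinearMap.mulRight K a)
  have hlN : lin x t ∈ V 1 ⊓ LinearMap.ker (LinearMap.mulRight K a) :=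
    ⟨lin_mem hA t, by simpa using hla⟩
  have h5 : S < V 1 ⊓ LinearMap.ker (LinearMap.mulRight K a) := by
    refine lt_of_le_of_ne (fun s hs => ⟨hS hs, by simpa using h2 s hs⟩) ?_
    intro h
    rw [← h] at hlN
    apply hp
    linear_combination lin x t * h3 _ hlN
  have h7 := Submodule.finrank_lt_finrank_of_lt h5
  change Module.finrank K (MulS V 1 a) + _ = _ at h4
  refine ⟨by omega, ?_⟩
  by_contra h8
  have h9 := finrank_map_add (V 1) (LinearMap.mulLeft K (lin x t))
  have h10 : (V 1).map (LinearMap.mulLeft K (lin x t)) = V 2 := by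
    refine Submodule.eq_of_le_of_finrank_le ?_ (by omega)
    rintro z ⟨y, hy, rfl⟩
    exact hA.mul_mem (lin_mem hA t) hy
  apply h0
  refine hA.nd (i := 1) (by omega) ha fun j => ?_
  by_contra hne
  obtain ⟨b, hb, hb'⟩ := hA.pairing (i := 2) (j := 2) rfl (hA.mul_mem (hA.x_mem j) ha) hne
  rw [← h10] at hb
  obtain ⟨c, hc, rfl⟩ := hb
  apply hb'
  rw [LinearMap.mulLeft_apply]
  linear_combination c * x j * hla

theorem GA.case5 [CharZero K] [Module.Finite K A] (hA : GA K x V 5)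
    (t : Fin n → K)
    (hL : ∀ a ∈ V 2, lin x t * a = 0 →
      ∃ P : MvPolynomial (Fin n) A, (∀ m, coeff m P ∈ V 2) ∧ LL x * P = 0 ∧ ev A t P = a)
    (hL3 : ∀ a ∈ V 1, lin x t ^ 3 * a = 0 →
      ∃ P : MvPolynomial (Fin n) A, (∀ m, coeff m P ∈ V 1) ∧ LL x ^ 3 * P = 0 ∧ ev A t P = a)
    (hp : lin x t ^ 5 ≠ 0)
    {a : A} (ha : a ∈ V 2) (hla : lin x t * a = 0) (hR : ¬ R1 V 1 a)
    (h6 : Module.finrank K (V 2) ≤ 6) : False := by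
  obtain ⟨S, hS, h1, h2, h3⟩ := hA.setup (by omega) t hL ha hla
  have h0 : a ≠ 0 := by rintro rfl; exact hR R1_zero
  have hk := one_le_ker ha h0 hla
  have hr := two_le_of_not_R1 hR
  set l := lin x t with hl
  have hl1 : l ∈ V 1 := lin_mem hA t
  set M := V 2 ⊓ LinearMap.ker (LinearMap.mulRight K a) with hM
  have hSM : S ≤ M := fun s hs => ⟨hS hs, by simpa using h2 s hs⟩
  have h4 := hA.iso (i := 2) (j := 3) rfl (U := M) (W := MulS V 1 a) inf_le_left (by
    rintro z hz
    obtain ⟨y, hy, rfl⟩ := mem_MulS.1 hz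
    exact hA.mul_mem hy ha) (by
    rintro u ⟨_, hu⟩ w hw
    obtain ⟨y, hy, rfl⟩ := mem_MulS.1 hw
    have hu' : u * a = 0 := by simpa using hu
    linear_combination y * hu')
  have hlV : (V 1).map (LinearMap.mulLeft K l) ≤ M := by
    rintro z ⟨y, hy, rfl⟩
    refine ⟨hA.mul_mem hl1 hy, ?_⟩
    show l * y * a = 0
    linear_combination y * hla
  have hlS : l * l ∉ S := by
    intro h
    apply hp
    linear_combination l * h3 _ h
  have hlM : l * l ∈ M := hlV ⟨l, hl1, rfl⟩
  have hlt : S < M := lt_of_le_of_ne hSM (by rintro h; exact hlS (h ▸ hlM))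
  have h7 := Submodule.finrank_lt_finrank_of_lt hlt
  -- `ℓ` is injective on `V 1`
  have hker1 : Module.finrank K (V 2 ⊓ LinearMap.ker (LinearMap.mulLeft K l) : Submodule K A) = 1 := by
    omega
  have hinj : ∀ b ∈ V 1, l * b = 0 → b = 0 := by
    intro b hb hlb
    by_contra hb0
    obtain ⟨v, hv, hv'⟩ := finrank_eq_one_iff'.1 hker1
    have hy : ∀ y ∈ V 1, ∃ c : K, y * b = c • (v : A) := by
      intro y hy
      obtain ⟨c, hc⟩ := hv' ⟨y * b, hA.mul_mem hy hb, by
        show l * (y * b) = 0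
        linear_combination y * hlb⟩
      exact ⟨c, by rw [← Submodule.coe_smul, hc]⟩
    obtain ⟨j, hj⟩ := hA.nz (by omega) hb hb0
    obtain ⟨c, hc⟩ := hy _ (hA.x_mem j)
    obtain ⟨c', hc'⟩ := hv' ⟨a, ha, by simpa using hla⟩
    have hc' : c' • (v : A) = a := by rw [← Submodule.coe_smul, hc']
    have hc0 : c ≠ 0 := by rintro rfl; apply hj; rw [hc, zero_smul]
    have hav : a = (c' * c⁻¹) • (x j * b) := by
      rw [hc, smul_smul, mul_assoc, inv_mul_cancel₀ hc0, mul_one, hc']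
    obtain ⟨w, hw⟩ := hA.R1_succ (j := 0) (a := b) ⟨v, hy⟩
    apply hR
    refine ⟨w, fun p hp' => ?_⟩
    obtain ⟨c2, hc2⟩ := hw _ (hA.mul_mem (i := 1) (j := 1) hp' (hA.x_mem j))
    refine ⟨c' * c⁻¹ * c2, ?_⟩
    rw [hav, mul_smul_comm, ← mul_assoc, hc2, smul_smul]
  -- dimension of `B'`
  set B := V 1 ⊓ LinearMap.ker (LinearMap.mulLeft K (l ^ 3)) with hB
  have hlB : l ∉ B := by
    rintro ⟨_, h⟩
    have h' : l ^ 3 * l = 0 := by simpa using h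
    apply hp
    linear_combination l * h'
  have hB1 : ∀ y ∈ V 1, ∃ c : K, y - c • l ∈ B := by
    -- M = S ⊔ span (l*l)
    have hSM' : S ⊔ Submodule.span K {l * l} = M := by
      refine Submodule.eq_of_le_of_finrank_le (sup_le hSM ?_) ?_
      · rw [Submodule.span_le]; rintro z rfl; exact hlM
      · have : S < S ⊔ Submodule.span K {l * l} := by
          refine lt_of_le_of_ne le_sup_left ?_
          intro h
          apply hlS
          rw [h]
          exact Submodule.mem_sup_right (Submodule.mem_span_singleton_self _)
        have := Submodule.finrank_lt_finrank_of_lt this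
        omega
    intro y hy
    have : l * y ∈ M := hlV ⟨y, hy, rfl⟩
    rw [← hSM'] at this
    obtain ⟨s, hs, z, hz, hsz⟩ := Submodule.mem_sup.1 this
    obtain ⟨c, rfl⟩ := Submodule.mem_span_singleton.1 hz
    refine ⟨c, Submodule.sub_mem _ hy (Submodule.smul_mem _ _ hl1), ?_⟩
    have hs' := h3 s hs
    show l ^ 3 * (y - c • l) = 0
    have : s = l * (y - c • l) := by
      rw [mul_sub, mul_smul_comm, ← hsz]; abel
    rw [this] at hs'
    linear_combination hs'
  have h3K : (3 : K) ≠ 0 := by norm_num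
  have hB2 : ∀ b ∈ B, l ^ 2 * b = 0 := by
    rintro b ⟨hb, hb'⟩
    have hb3 : l ^ 3 * b = 0 := by simpa using hb'
    obtain ⟨P, hP, hLP, hPb⟩ := hL3 b hb hb3
    -- for each `j`, `l^2 x_j b = c l^4`
    have hj : ∀ j, ∃ c : K, l ^ 2 * (x j * b) = c • l ^ 4 := by
      intro j
      have e := congrArg (pderiv j) hLP
      rw [Derivation.leibniz, Derivation.leibniz_pow, pderiv_LL, map_zero] at e
      have e' := congrArg (ev A t) e
      simp only [smul_eq_mul, nsmul_eq_mul, map_add, map_mul, map_pow, map_natCast, ev_C, ev_LL,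
        hPb, map_zero, ← hl] at e'
      obtain ⟨c, _, hc⟩ := hB1 _ (ev_mem t (V 1) _ (coeff_pderiv_mem _ P j hP))
      have hc' : l ^ 3 * (ev A t (pderiv j P) - c • l) = 0 := by simpa using hc
      refine ⟨-((3 : K)⁻¹ * c), ?_⟩
      have e3 : (3 : K) • (l ^ 2 * (x j * b)) = -(c • l ^ 4) := by
        rw [mul_sub, mul_smul_comm] at hc'
        rw [Algebra.smul_def, map_ofNat]
        rw [show l ^ 4 = l ^ 3 * l by ring]
        push_cast at e'
        linear_combination e' - hc'
      calc l ^ 2 * (x j * b) = (3 : K)⁻¹ • (3 : K) • (l ^ 2 * (x j * b)) := by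
            rw [smul_smul, inv_mul_cancel₀ h3K, one_smul]
        _ = _ := by rw [e3, smul_neg, smul_smul, neg_smul]
    have hy0 : ∀ y ∈ V 1, ∃ c : K, l ^ 2 * (y * b) = c • l ^ 4 := by
      intro y hy
      have : MulS V 1 b ≤ (Submodule.span K {l ^ 4}).comap (LinearMap.mulLeft K (l ^ 2)) := by
        refine hA.MulS_succ fun s => hA.MulS_zero ?_
        obtain ⟨c, hc⟩ := hj s
        exact Submodule.mem_span_singleton.2 ⟨c, hc.symm⟩
      obtain ⟨c, hc⟩ := Submodule.mem_span_singleton.1 (this (mem_MulS.2 ⟨y, hy, rfl⟩))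
      exact ⟨c, hc.symm⟩
    have hyB : ∀ y ∈ B, l ^ 2 * (y * b) = 0 := by
      rintro y ⟨hy, hy'⟩
      obtain ⟨c, hc⟩ := hy0 y hy
      have hy3 : l ^ 3 * y = 0 := by simpa using hy'
      have h5 : c • l ^ 5 = 0 := by
        rw [show l ^ 5 = l * l ^ 4 by ring, ← mul_smul_comm, ← hc]
        linear_combination b * hy3
      rcases smul_eq_zero.1 h5 with h | h
      · rw [hc, h, zero_smul]
      · exact absurd h hp
    refine hA.nd (i := 2 + 1) (by omega) ?_ fun j => ?_
    · exact hA.mul_mem (by rw [pow_two]; exact hA.mul_mem (i := 1) (j := 1) hl1 hl1) hb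
    · obtain ⟨c, hc⟩ := hB1 _ (hA.x_mem j)
      have h8 := hyB _ hc
      have h9 : x j * (l ^ 2 * b) = l ^ 2 * ((x j - c • l) * b) + c • (l ^ 3 * b) := by
        rw [sub_mul, mul_sub, smul_mul_assoc, mul_smul_comm]
        rw [show l ^ 3 * b = l ^ 2 * (l * b) by ring]
        ring
      rw [h9, h8, hb3, smul_zero, add_zero]
  -- hence dim B ≤ 1
  have hBd : Module.finrank K B ≤ 1 := by
    have e := finrank_map_add B (LinearMap.mulLeft K l)
    have e1 : B ⊓ LinearMap.ker (LinearMap.mulLeft K l) = ⊥ := by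
      rw [eq_bot_iff]
      rintro z ⟨⟨hz, _⟩, hz'⟩
      simpa using hinj z hz (by simpa using hz')
    rw [e1, finrank_bot] at e
    have e2 : B.map (LinearMap.mulLeft K l) ≤
        V 2 ⊓ LinearMap.ker (LinearMap.mulLeft K l) := by
      rintro z ⟨b, hb, rfl⟩
      refine ⟨hA.mul_mem hl1 hb.1, ?_⟩
      show l * (l * b) = 0
      linear_combination hB2 b hb
    have := Submodule.finrank_mono e2
    omega
  have hV1 : Module.finrank K (V 1) ≤ 2 := by
    have : V 1 ≤ B ⊔ Submodule.span K {l} := by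
      intro y hy
      obtain ⟨c, hc⟩ := hB1 y hy
      rw [show y = (y - c • l) + c • l by abel]
      exact Submodule.add_mem_sup hc (Submodule.smul_mem _ _ (Submodule.mem_span_singleton_self _))
    have e1 := Submodule.finrank_mono this
    have e2 := Submodule.finrank_add_le_finrank_add_finrank B (Submodule.span K {l})
    have e3 : Module.finrank K (Submodule.span K {l}) ≤ 1 := by
      simpa using finrank_span_le_card (R := K) ({l} : Set A)
    omega
  have e4 := finrank_map_add (V 1) (LinearMap.mulRight K a)
  change Module.finrank K (MulS V 1 a) + _ = _ at e4
  have e5 : Module.finrank K (V 1 ⊓ LinearMap.ker (LinearMap.mulRight K a) : Submodule K A) = 0 := by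
    omega
  rw [Submodule.finrank_eq_zero] at e5
  have e6 : l ∈ (V 1 ⊓ LinearMap.ker (LinearMap.mulRight K a) : Submodule K A) :=
    ⟨hl1, by simpa using hla⟩
  rw [e5] at e6
  apply hp
  have : l = 0 := by simpa using e6
  rw [this]; ring

end Abstract5



section Abstract6

variable {K : Type*} [Field K] {n : ℕ} {A : Type*} [CommRing A] [Algebra K A]
variable {x : Fin n → A} {V : ℕ → Submodule K A} {d : ℕ}

theorem GA.core [CharZero K] [Module.Finite K A] (hA : GA K x V d) {k : ℕ}
    (hk : d = 2 * k + 1 ∨ d = 2 * k + 2) (h6 : ∀ i, Module.finrank K (V i) ≤ 6)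
    (hex3 : d = 3 → Module.finrank K (V 1) ≤ 4)
    (hex4 : d = 4 → ¬ (Module.finrank K (V 1) = 6 ∧ Module.finrank K (V 2) = 6)) :
    ∃ t : Fin n → K, ∀ a ∈ V k, lin x t * a = 0 → a = 0 := by
  have : Infinite K := inferInstance
  rcases Nat.eq_zero_or_pos k with rfl | hkpos
  · have h1 : (1 : A) ≠ 0 := by
      obtain ⟨v, hv, _⟩ := finrank_eq_one_iff'.1 hA.top
      intro h
      exact hv (Subtype.ext (by
        rw [← one_mul (v : A), h, zero_mul]; rfl))
    obtain ⟨t, ht⟩ := (hA.gen_ne (by omega) hA.one_mem h1).exists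
    refine ⟨t, fun a ha hla => ?_⟩
    obtain ⟨c, rfl⟩ := Submodule.mem_span_singleton.1 (hA.zero_le ha)
    rw [mul_smul_comm] at hla
    rcases smul_eq_zero.1 hla with h | h
    · rw [h, zero_smul]
    · exact absurd h ht
  by_cases hG : Gen (fun t : Fin n → K => ∀ a ∈ V k, a ≠ 0 → lin x t * a = 0 → ¬ R1 V 1 a)
  · obtain ⟨t, ⟨⟨ht1, ht2⟩, ht3⟩, ht4⟩ :=
      (((hG.and (lifting (V k) (LL x))).and (lifting (V 1) (LL x ^ 3))).and hA.gen_pow).exists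
    rw [ev_LL] at ht2
    rw [map_pow, ev_LL] at ht3
    refine ⟨t, fun a ha hla => ?_⟩
    by_contra h0
    have hR := ht1 a ha h0 hla
    by_cases hd : 6 ≤ d
    · obtain ⟨P, hP, hLP, hPa⟩ := ht2 a ha hla
      have := hA.case_ge (k := k) (by omega) t hP hLP (by rwa [hPa])
      have := h6 k
      omega
    · have hcases : (k = 1 ∧ d = 3) ∨ (k = 1 ∧ d = 4) ∨ (k = 2 ∧ d = 5) := by omega
      rcases hcases with ⟨rfl, rfl⟩ | ⟨rfl, rfl⟩ | ⟨rfl, rfl⟩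
      · have := hA.case3 (by omega) t ht2 ha hla hR
        have := hex3 rfl
        omega
      · obtain ⟨h1, h2⟩ := hA.case4 t ht2 ht4 ha hla hR (h6 1)
        exact hex4 rfl ⟨h1, le_antisymm (h6 2) h2⟩
      · exact hA.case5 t ht2 ht3 ht4 ha hla hR (h6 2)
  · exfalso
    have h1 := hA.rank_one_case (k := k) (by omega) hG k le_rfl (by omega)
    have h2 := hA.rank_one_case (k := k) (by omega) hG (k + 1) (by omega) (by omega)
    have h3 := h6 k
    have h4 := h6 (k + 1)
    have hcases : (k = 1 ∧ d = 3) ∨ (k = 1 ∧ d = 4) := by omega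
    rcases hcases with ⟨rfl, rfl⟩ | ⟨rfl, rfl⟩
    · have := hex3 rfl
      omega
    · exact hex4 rfl ⟨by omega, by simp only [Nat.reduceAdd] at h2 h4; omega⟩

theorem GA.wlp [CharZero K] [Module.Finite K A] (hA : GA K x V d)
    (hbot : ∀ i, d < i → V i = ⊥)
    (hsym : ∀ i ≤ d, Module.finrank K (V i) = Module.finrank K (V (d - i)))
    (h6 : ∀ i, Module.finrank K (V i) ≤ 6)
    (hex3 : d = 3 → Module.finrank K (V 1) ≤ 4)
    (hex4 : d = 4 → ¬ (Module.finrank K (V 1) = 6 ∧ Module.finrank K (V 2) = 6)) :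
    ∃ t : Fin n → K, ∀ i, (∀ a ∈ V i, lin x t * a = 0 → a = 0) ∨
      (∀ b ∈ V (i + 1), ∃ a ∈ V i, lin x t * a = b) := by
  have hbig : ∀ (t : Fin n → K) (i : ℕ), d ≤ i → ∀ b ∈ V (i + 1), ∃ a ∈ V i, lin x t * a = b := by
    intro t i hi b hb
    rw [hbot (i + 1) (by omega)] at hb
    refine ⟨0, Submodule.zero_mem _, ?_⟩
    rw [mul_zero]; exact ((Submodule.mem_bot K).1 hb).symm
  rcases Nat.eq_zero_or_pos d with rfl | hd
  · exact ⟨0, fun i => Or.inr (hbig 0 i (Nat.zero_le _))⟩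
  obtain ⟨k, hk⟩ : ∃ k, d = 2 * k + 1 ∨ d = 2 * k + 2 := ⟨(d - 1) / 2, by omega⟩
  obtain ⟨t, ht⟩ := hA.core hk h6 hex3 hex4
  refine ⟨t, ?_⟩
  have hinj : ∀ e i, i + e = k → ∀ a ∈ V i, lin x t * a = 0 → a = 0 := by
    intro e
    induction e with
    | zero => intro i hi; rw [add_zero] at hi; subst hi; exact ht
    | succ e ih =>
      intro i hi a ha hla
      refine hA.nd (i := i) (by omega) ha fun j => ?_
      refine ih (1 + i) (by omega) _ (hA.mul_mem (hA.x_mem j) ha) ?_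
      linear_combination x j * hla
  intro i
  by_cases hik : i ≤ k
  · exact Or.inl (hinj (k - i) i (by omega))
  right
  by_cases hid : d ≤ i
  · exact hbig t i hid
  obtain ⟨j, hj⟩ : ∃ j, i + (j + 1) = d := ⟨d - i - 1, by omega⟩
  have hjk : j ≤ k := by omega
  have hji := hinj (k - j) j (by omega)
  have e1 := finrank_map_add (V i) (LinearMap.mulLeft K (lin x t))
  have e2 := finrank_map_add (V j) (LinearMap.mulLeft K (lin x t))
  have e3 : V j ⊓ LinearMap.ker (LinearMap.mulLeft K (lin x t)) = ⊥ := by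
    rw [eq_bot_iff]
    rintro z ⟨hz, hz'⟩
    simpa using hji z hz (by simpa using hz')
  rw [e3, finrank_bot] at e2
  have e4 := hA.iso hj (U := V i ⊓ LinearMap.ker (LinearMap.mulLeft K (lin x t)))
    (W := (V j).map (LinearMap.mulLeft K (lin x t))) inf_le_left (by
      rintro z ⟨y, hy, rfl⟩
      rw [add_comm j]
      exact hA.mul_mem (lin_mem hA t) hy) (by
      rintro u ⟨_, hu⟩ w ⟨y, hy, rfl⟩
      have hu' : lin x t * u = 0 := by simpa using hu
      show u * (lin x t * y) = 0
      linear_combination y * hu')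
  have e5 := hsym (i + 1) (by omega)
  rw [show d - (i + 1) = j by omega] at e5
  have e6 : (V i).map (LinearMap.mulLeft K (lin x t)) = V (i + 1) := by
    refine Submodule.eq_of_le_of_finrank_le ?_ (by omega)
    rintro z ⟨y, hy, rfl⟩
    rw [add_comm i]
    exact hA.mul_mem (lin_mem hA t) hy
  intro b hb
  rw [← e6] at hb
  obtain ⟨a, ha, hab⟩ := hb
  exact ⟨a, ha, hab⟩

end Abstract6



section Translate

variable {K : Type*} [Field K] {n : ℕ}

theorem mem_piece {I : Ideal (MvPolynomial (Fin n) K)} {i : ℕ}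
    {z : MvPolynomial (Fin n) K ⧸ I} :
    z ∈ piece I i ↔ ∃ p : MvPolynomial (Fin n) K, p.IsHomogeneous i ∧ Ideal.Quotient.mk I p = z := by
  simp [piece, Submodule.mem_map, mem_homogeneousSubmodule]

theorem mk_mem_piece {I : Ideal (MvPolynomial (Fin n) K)} {i : ℕ} {p : MvPolynomial (Fin n) K}
    (hp : p.IsHomogeneous i) : Ideal.Quotient.mk I p ∈ piece I i := mem_piece.2 ⟨p, hp, rfl⟩

theorem mk_smul (I : Ideal (MvPolynomial (Fin n) K)) (c : K) (p : MvPolynomial (Fin n) K) :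
    Ideal.Quotient.mk I (c • p) = c • Ideal.Quotient.mk I p :=
  (Ideal.Quotient.mkₐ K I).toLinearMap.map_smul c p

theorem homog_succ_mem_span {i : ℕ} {p : MvPolynomial (Fin n) K} (hp : p.IsHomogeneous (i + 1)) :
    p ∈ Submodule.span K {z | ∃ j, ∃ q : MvPolynomial (Fin n) K, q.IsHomogeneous i ∧
      z = X j * q} := by
  classical
  rw [p.as_sum]
  refine Submodule.sum_mem _ fun s hs => ?_
  have hdeg : s.degree = i + 1 := by
    have := hp (mem_support_iff.1 hs)
    rw [Finsupp.degree_eq_weight_one]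
    exact this
  have : ∃ j, s j ≠ 0 := by
    by_contra! h
    have : s = 0 := Finsupp.ext h
    rw [this, map_zero] at hdeg
    omega
  obtain ⟨j, hj⟩ := this
  have hle : Finsupp.single j 1 ≤ s := by
    rw [Finsupp.single_le_iff]; omega
  have hs' : s = Finsupp.single j 1 + (s - Finsupp.single j 1) := (add_tsub_cancel_of_le hle).symm
  refine Submodule.subset_span ⟨j, monomial (s - Finsupp.single j 1) (coeff s p), ?_, ?_⟩
  · apply isHomogeneous_monomial
    have := congrArg Finsupp.degree hs'
    rw [map_add, Finsupp.degree_single] at this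
    omega
  · rw [X, monomial_mul, one_mul, ← hs']

theorem piece_zero_le (I : Ideal (MvPolynomial (Fin n) K)) : piece I 0 ≤ Submodule.span K {1} := by
  intro z hz
  obtain ⟨p, hp, rfl⟩ := mem_piece.1 hz
  have h1 := (totalDegree_eq_zero_iff_eq_C (p := p)).1 (by
    exact Nat.le_zero.1 hp.totalDegree_le)
  rw [h1]
  refine Submodule.mem_span_singleton.2 ⟨coeff 0 p, ?_⟩
  rw [← map_one (Ideal.Quotient.mk I), ← mk_smul, smul_eq_C_mul, mul_one]

theorem piece_succ_le (I : Ideal (MvPolynomial (Fin n) K)) (i : ℕ) : piece I (i + 1) ≤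
    Submodule.span K {z | ∃ j, ∃ a ∈ piece I i, z = Ideal.Quotient.mk I (X j) * a} := by
  intro z hz
  obtain ⟨p, hp, rfl⟩ := mem_piece.1 hz
  have h1 := homog_succ_mem_span hp
  have h2 : Submodule.span K {z | ∃ j, ∃ q : MvPolynomial (Fin n) K, q.IsHomogeneous i ∧
      z = X j * q} ≤ (Submodule.span K {z | ∃ j, ∃ a ∈ piece I i,
        z = Ideal.Quotient.mk I (X j) * a}).comap (Ideal.Quotient.mkₐ K I).toLinearMap := by
    rw [Submodule.span_le]
    rintro _ ⟨j, q, hq, rfl⟩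
    exact Submodule.subset_span ⟨j, _, mk_mem_piece hq, by simp⟩
  exact h2 h1

theorem piece_mul_mem {I : Ideal (MvPolynomial (Fin n) K)} {i j : ℕ}
    {a b : MvPolynomial (Fin n) K ⧸ I} (ha : a ∈ piece I i) (hb : b ∈ piece I j) :
    a * b ∈ piece I (i + j) := by
  obtain ⟨p, hp, rfl⟩ := mem_piece.1 ha
  obtain ⟨q, hq, rfl⟩ := mem_piece.1 hb
  rw [← map_mul]
  exact mk_mem_piece (hp.mul hq)

theorem piece_fg (I : Ideal (MvPolynomial (Fin n) K)) (i : ℕ) : (piece I i).FG := by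
  induction i with
  | zero =>
    have : FiniteDimensional K (Submodule.span K {(1 : MvPolynomial (Fin n) K ⧸ I)}) :=
      inferInstance
    have := Submodule.finiteDimensional_of_le (piece_zero_le I)
    exact (Submodule.fg_iff_finiteDimensional _).2 this
  | succ i ih =>
    have hle : piece I (i + 1) ≤
        ⨆ j, (piece I i).map (LinearMap.mulLeft K (Ideal.Quotient.mk I (X j))) := by
      refine (piece_succ_le I i).trans (Submodule.span_le.2 ?_)
      rintro _ ⟨j, a, ha, rfl⟩
      exact Submodule.mem_iSup_of_mem j ⟨a, ha, rfl⟩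
    have hfg : (⨆ j, (piece I i).map (LinearMap.mulLeft K (Ideal.Quotient.mk I (X j)))).FG :=
      Submodule.fg_iSup _ fun j => ih.map _
    have := (Submodule.fg_iff_finiteDimensional _).1 hfg
    have := Submodule.finiteDimensional_of_le hle
    exact (Submodule.fg_iff_finiteDimensional _).2 this

theorem piece_eq_bot {I : Ideal (MvPolynomial (Fin n) K)} {i : ℕ} (h : hf I i = 0) :
    piece I i = ⊥ := by
  have := (Submodule.fg_iff_finiteDimensional _).1 (piece_fg I i)
  exact Submodule.finrank_eq_zero.1 h

theorem finite_of_AG {I : Ideal (MvPolynomial (Fin n) K)} {d : ℕ} (h : ∀ i, d < i → hf I i = 0) :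
    Module.Finite K (MvPolynomial (Fin n) K ⧸ I) := by
  refine ⟨?_⟩
  have : (⊤ : Submodule K (MvPolynomial (Fin n) K ⧸ I))
      = ⨆ i : Fin (d + 1), piece I i := by
    symm
    rw [eq_top_iff]
    intro z _
    obtain ⟨p, rfl⟩ := Ideal.Quotient.mk_surjective z
    rw [← sum_homogeneousComponent p, map_sum]
    refine Submodule.sum_mem _ fun i _ => ?_
    have h1 : Ideal.Quotient.mk I (homogeneousComponent i p) ∈ piece I i :=
      mk_mem_piece (homogeneousComponent_isHomogeneous i p)
    by_cases hi : d < i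
    · rw [piece_eq_bot (h i hi)] at h1
      rw [(Submodule.mem_bot K).1 h1]
      exact Submodule.zero_mem _
    · exact Submodule.mem_iSup_of_mem (⟨i, by omega⟩ : Fin (d + 1)) h1
  rw [this]
  exact Submodule.fg_iSup _ fun j => piece_fg I j

theorem AG_to_GA {I : Ideal (MvPolynomial (Fin n) K)} {d : ℕ} (h : IsArtinianGorenstein I d) :
    GA K (fun j => Ideal.Quotient.mk I (X j)) (piece I) d where
  one_mem := by
    rw [← map_one (Ideal.Quotient.mk I)]
    exact mk_mem_piece (isHomogeneous_one _ _)
  mul_mem := piece_mul_mem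
  x_mem j := mk_mem_piece (isHomogeneous_X _ _)
  zero_le := piece_zero_le I
  succ_le := piece_succ_le I
  nd := by
    intro i a hi ha hx
    have h1 : a ∈ socle I := by
      simp only [socle, Submodule.mem_iInf]
      intro j
      simpa using hx j
    have h2 := h.2.2.2.2.2 h1
    obtain ⟨p, hp, hpa⟩ := mem_piece.1 ha
    obtain ⟨q, hq, hqa⟩ := mem_piece.1 h2
    have h3 : p - q ∈ I := Ideal.Quotient.eq.1 (hpa.trans hqa.symm)
    have h4 := h.1 _ h3 i
    rw [map_sub, homogeneousComponent_of_mem hp, homogeneousComponent_of_mem hq, if_pos rfl,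
      if_neg (by omega), sub_zero] at h4
    rw [← hpa]
    exact Ideal.Quotient.eq_zero_iff_mem.2 h4
  top := h.2.1

theorem wlp_of_AG [CharZero K] {I : Ideal (MvPolynomial (Fin n) K)} {d : ℕ}
    (h : IsArtinianGorenstein I d) (h6 : ∀ i, hf I i ≤ 6) (hex3 : d = 3 → hf I 1 ≤ 4)
    (hex4 : d = 4 → ¬ (hf I 1 = 6 ∧ hf I 2 = 6)) : WLP I := by
  have := finite_of_AG h.2.2.1
  obtain ⟨t, ht⟩ := (AG_to_GA h).wlp (fun i hi => piece_eq_bot (h.2.2.1 i hi)) h.2.2.2.1 h6 hex3 hex4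
  refine ⟨∑ j, t j • X j, ?_, ?_⟩
  · refine IsHomogeneous.sum _ _ _ fun j _ => ?_
    rw [smul_eq_C_mul]
    simpa using (isHomogeneous_C (Fin n) (t j)).mul (isHomogeneous_X K j)
  · have h1 : Ideal.Quotient.mk I (∑ j, t j • X j) = lin (fun j => Ideal.Quotient.mk I (X j)) t := by
      rw [map_sum, lin]
      exact Finset.sum_congr rfl fun j _ => mk_smul _ _ _
    rw [h1]
    exact ht

end Translate



section Macaulay

variable {K : Type*} [Field K] {n : ℕ}

/-- The ideal attached to a linear functional on the polynomial ring. -/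
def annI (φ : MvPolynomial (Fin n) K →ₗ[K] K) : Ideal (MvPolynomial (Fin n) K) where
  carrier := {p | ∀ q, φ (p * q) = 0}
  zero_mem' := by intro q; simp
  add_mem' := by
    intro a b ha hb q
    rw [add_mul, map_add, ha q, hb q, add_zero]
  smul_mem' := by
    intro c p hp q
    rw [smul_eq_mul, mul_comm c p, mul_assoc]
    exact hp _

theorem mem_annI {φ : MvPolynomial (Fin n) K →ₗ[K] K} {p : MvPolynomial (Fin n) K} :
    p ∈ annI φ ↔ ∀ q, φ (p * q) = 0 := Iff.rfl

variable {φ : MvPolynomial (Fin n) K →ₗ[K] K} {d : ℕ}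

theorem phi_comp (hφ : ∀ i ≠ d, ∀ p : MvPolynomial (Fin n) K, p.IsHomogeneous i → φ p = 0)
    {i j : ℕ} (hij : i + j = d) (p q : MvPolynomial (Fin n) K) (hq : q.IsHomogeneous j) :
    φ (homogeneousComponent i p * q) = φ (p * q) := by
  classical
  conv_rhs => rw [← sum_homogeneousComponent p, Finset.sum_mul, map_sum]
  by_cases hi : i ∈ Finset.range (p.totalDegree + 1)
  · rw [Finset.sum_eq_single i]
    · intro l _ hl
      exact hφ (l + j) (by omega) _ ((homogeneousComponent_isHomogeneous l p).mul hq)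
    · intro h; exact absurd hi h
  · rw [Finset.sum_eq_zero]
    · rw [homogeneousComponent_eq_zero _ _ (by simpa using hi)]; simp
    · intro l hl
      have : l ≠ i := by rintro rfl; exact hi hl
      exact hφ (l + j) (by omega) _ ((homogeneousComponent_isHomogeneous l p).mul hq)

theorem homog_mem_annI (hφ : ∀ i ≠ d, ∀ p : MvPolynomial (Fin n) K, p.IsHomogeneous i → φ p = 0)
    {i : ℕ} {p : MvPolynomial (Fin n) K} (hp : p.IsHomogeneous i)
    (h : ∀ j, i + j = d → ∀ q : MvPolynomial (Fin n) K, q.IsHomogeneous j → φ (p * q) = 0) :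
    p ∈ annI φ := by
  intro q
  rw [← sum_homogeneousComponent q, Finset.mul_sum, map_sum]
  refine Finset.sum_eq_zero fun j _ => ?_
  by_cases hij : i + j = d
  · exact h j hij _ (homogeneousComponent_isHomogeneous j q)
  · exact hφ _ hij _ (hp.mul (homogeneousComponent_isHomogeneous j q))

theorem annI_homog (hφ : ∀ i ≠ d, ∀ p : MvPolynomial (Fin n) K, p.IsHomogeneous i → φ p = 0) :
    IsHomogIdeal (annI φ) := by
  intro p hp i
  refine homog_mem_annI hφ (homogeneousComponent_isHomogeneous i p) fun j hij q hq => ?_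
  rw [phi_comp hφ hij p q hq]
  exact hp q

/-- The functional induced on the quotient. -/
noncomputable def psi (φ : MvPolynomial (Fin n) K →ₗ[K] K) : (MvPolynomial (Fin n) K ⧸ annI φ) →ₗ[K] K :=
  Submodule.liftQ ((annI φ).restrictScalars K) φ (by
    intro p hp
    have := (mem_annI.1 hp) 1
    simpa using this)

theorem psi_mk (p : MvPolynomial (Fin n) K) : psi φ (Ideal.Quotient.mk (annI φ) p) = φ p := rfl

theorem annI_top (hφ : ∀ i ≠ d, ∀ p : MvPolynomial (Fin n) K, p.IsHomogeneous i → φ p = 0)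
    (i : ℕ) (hi : d < i) : piece (annI φ) i = ⊥ := by
  rw [eq_bot_iff]
  intro z hz
  obtain ⟨p, hp, rfl⟩ := mem_piece.1 hz
  rw [Submodule.mem_bot, Ideal.Quotient.eq_zero_iff_mem]
  exact homog_mem_annI hφ hp fun j hj => by omega

theorem annI_sym_le (hφ : ∀ i ≠ d, ∀ p : MvPolynomial (Fin n) K, p.IsHomogeneous i → φ p = 0)
    {i j : ℕ} (hij : i + j = d) : hf (annI φ) i ≤ hf (annI φ) j := by
  have := (Submodule.fg_iff_finiteDimensional _).1 (piece_fg (annI φ) i)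
  have := (Submodule.fg_iff_finiteDimensional _).1 (piece_fg (annI φ) j)
  let f : piece (annI φ) i →ₗ[K] Module.Dual K (piece (annI φ) j) :=
    { toFun := fun a => ((psi φ).comp (LinearMap.mulLeft K (a : MvPolynomial (Fin n) K ⧸ annI φ))).comp
        (piece (annI φ) j).subtype
      map_add' := by intro a b; ext c; simp [add_mul]
      map_smul' := by intro a b; ext c; simp [smul_mul_assoc] }
  have hf' : Function.Injective f := by
    rw [injective_iff_map_eq_zero]
    rintro ⟨a, ha⟩ h
    obtain ⟨p, hp, rfl⟩ := mem_piece.1 ha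
    rw [Subtype.ext_iff]
    show Ideal.Quotient.mk (annI φ) p = 0
    rw [Ideal.Quotient.eq_zero_iff_mem]
    refine homog_mem_annI hφ hp fun j' hj' q hq => ?_
    obtain rfl : j' = j := by omega
    have := congrArg (fun g => g ⟨Ideal.Quotient.mk (annI φ) q, mk_mem_piece hq⟩) h
    exact this
  have := LinearMap.finrank_le_finrank_of_injective hf'
  rw [Subspace.dual_finrank_eq] at this
  exact this

theorem annI_AG (hφ : ∀ i ≠ d, ∀ p : MvPolynomial (Fin n) K, p.IsHomogeneous i → φ p = 0)
    (h0 : φ ≠ 0) : IsArtinianGorenstein (annI φ) d := by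
  have hd1 : hf (annI φ) d = 1 := by
    have := (Submodule.fg_iff_finiteDimensional _).1 (piece_fg (annI φ) d)
    have hle : hf (annI φ) d ≤ 1 := by
      refine (annI_sym_le hφ (add_zero d)).trans ?_
      have : FiniteDimensional K (Submodule.span K {(1 : MvPolynomial (Fin n) K ⧸ annI φ)}) :=
        inferInstance
      refine (Submodule.finrank_mono (piece_zero_le (annI φ))).trans ?_
      simpa using finrank_span_le_card (R := K) ({1} : Set (MvPolynomial (Fin n) K ⧸ annI φ))
    have hne : hf (annI φ) d ≠ 0 := by
      intro h
      have hb := piece_eq_bot h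
      apply h0
      ext1 m
      ext
      simp only [LinearMap.comp_apply, LinearMap.zero_apply]
      by_cases hm : m.degree = d
      · have h1 : Ideal.Quotient.mk (annI φ) (monomial m (1 : K)) ∈ piece (annI φ) d :=
          mk_mem_piece (isHomogeneous_monomial _ hm)
        rw [hb, Submodule.mem_bot, Ideal.Quotient.eq_zero_iff_mem] at h1
        have h2 := h1 1
        rw [mul_one] at h2
        exact h2
      · exact hφ _ hm _ (isHomogeneous_monomial _ rfl)
    omega
  have hsoc : socle (annI φ) = piece (annI φ) d := by
    apply le_antisymm
    · intro z hz
      obtain ⟨p, rfl⟩ := Ideal.Quotient.mk_surjective z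
      have hx : ∀ j, X j * p ∈ annI φ := by
        intro j
        have := (Submodule.mem_iInf _).1 hz j
        rw [LinearMap.mem_ker, LinearMap.mulLeft_apply, ← map_mul,
          Ideal.Quotient.eq_zero_iff_mem] at this
        exact this
      have hpd := homogeneousComponent_isHomogeneous d p
      refine mem_piece.2 ⟨_, hpd, ?_⟩
      rw [eq_comm, Ideal.Quotient.eq]
      intro q
      induction q using MvPolynomial.induction_on with
      | C c =>
        rw [sub_mul, map_sub, phi_comp hφ (add_zero d) p _ (isHomogeneous_C _ _), sub_self]
      | add q r hq hr => rw [mul_add, map_add, hq, hr, add_zero]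
      | mul_X q j _ =>
        have h1 : φ (X j * homogeneousComponent d p * q) = 0 :=
          homog_mem_annI hφ ((isHomogeneous_X K j).mul hpd) (fun j hj => by omega) q
        have h2 := hx j q
        rw [show (p - homogeneousComponent d p) * (q * X j)
          = X j * p * q - X j * homogeneousComponent d p * q by ring, map_sub, h1, h2, sub_zero]
    · intro z hz
      refine (Submodule.mem_iInf _).2 fun j => ?_
      have h1 := piece_mul_mem (mk_mem_piece (I := annI φ) (isHomogeneous_X K j)) hz
      rw [annI_top hφ _ (by omega), Submodule.mem_bot] at h1
      exact h1
  refine ⟨annI_homog hφ, hd1, ?_, ?_, ?_, hsoc.le⟩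
  · intro i hi
    rw [hf, annI_top hφ i hi, finrank_bot]
  · intro i hi
    exact le_antisymm (annI_sym_le hφ (by omega)) (annI_sym_le hφ (by omega))
  · rw [hsoc]; exact hd1

end Macaulay



section MonomialFunctional

variable {K : Type*} [Field K] {n : ℕ}

/-- The monomial with exponent vector `v`. -/
noncomputable def mon (K : Type*) [Field K] {n : ℕ} (v : Fin n → ℕ) : MvPolynomial (Fin n) K :=
  monomial (Finsupp.equivFunOnFinite.symm v) 1

/-- The sum of the coefficients at the monomials in `T`. -/
noncomputable def phiT (K : Type*) [Field K] {n : ℕ} (T : Finset (Fin n → ℕ)) :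
    MvPolynomial (Fin n) K →ₗ[K] K :=
  ∑ v ∈ T, lcoeff K (Finsupp.equivFunOnFinite.symm v)

theorem mon_mul (v w : Fin n → ℕ) : mon K v * mon K w = mon K (v + w) := by
  rw [mon, mon, mon, monomial_mul, one_mul]
  congr 2
  ext i; simp

theorem mon_homog {v : Fin n → ℕ} {i : ℕ} (hv : ∑ j, v j = i) : (mon K v).IsHomogeneous i := by
  apply isHomogeneous_monomial
  rw [Finsupp.degree_eq_sum, ← hv]
  rfl

theorem X_eq_mon (i : Fin n) : (X i : MvPolynomial (Fin n) K) = mon K (Pi.single i 1) := by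
  rw [X, mon]
  congr 2
  rw [Finsupp.equivFunOnFinite_symm_single]

theorem phiT_mon (T : Finset (Fin n → ℕ)) (v : Fin n → ℕ) :
    phiT K T (mon K v) = if v ∈ T then 1 else 0 := by
  classical
  simp only [phiT, LinearMap.sum_apply, lcoeff_apply, mon, coeff_monomial,
    EmbeddingLike.apply_eq_iff_eq]
  rw [Finset.sum_ite_eq]

theorem phiT_hom {T : Finset (Fin n → ℕ)} {d : ℕ} (hT : ∀ v ∈ T, ∑ j, v j = d) :
    ∀ i ≠ d, ∀ p : MvPolynomial (Fin n) K, p.IsHomogeneous i → phiT K T p = 0 := by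
  intro i hi p hp
  simp only [phiT, LinearMap.sum_apply, lcoeff_apply]
  refine Finset.sum_eq_zero fun v hv => ?_
  apply hp.coeff_eq_zero
  rw [Finsupp.degree_eq_sum]
  have : ∑ j, (Finsupp.equivFunOnFinite.symm v) j = d := hT v hv
  rw [this]; exact hi.symm

theorem mem_annI_of_mon {φ : MvPolynomial (Fin n) K →ₗ[K] K} {p : MvPolynomial (Fin n) K}
    (h : ∀ z, φ (p * mon K z) = 0) : p ∈ annI φ := by
  intro q
  rw [q.as_sum, Finset.mul_sum, map_sum]
  refine Finset.sum_eq_zero fun m _ => ?_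
  have : monomial m (coeff m q) = coeff m q • mon K (Finsupp.equivFunOnFinite m) := by
    rw [mon, smul_monomial, smul_eq_mul, mul_one]; simp
  rw [this, mul_smul_comm, map_smul, h, smul_zero]

theorem mon_zero {T : Finset (Fin n → ℕ)} {v : Fin n → ℕ} (h : ∀ t ∈ T, ¬ ∀ k, v k ≤ t k) :
    Ideal.Quotient.mk (annI (phiT K T)) (mon K v) = 0 := by
  rw [Ideal.Quotient.eq_zero_iff_mem]
  refine mem_annI_of_mon fun z => ?_
  rw [mon_mul, phiT_mon, if_neg]
  exact fun hz => h _ hz (fun k => Nat.le_add_right _ _)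

theorem mon_eq {T : Finset (Fin n → ℕ)} {v w : Fin n → ℕ}
    (h : ∀ t ∈ T, ((∀ k, v k ≤ t k) → w + (t - v) ∈ T) ∧ ((∀ k, w k ≤ t k) → v + (t - w) ∈ T)) :
    Ideal.Quotient.mk (annI (phiT K T)) (mon K v) = Ideal.Quotient.mk (annI (phiT K T)) (mon K w) := by
  rw [Ideal.Quotient.eq]
  refine mem_annI_of_mon fun z => ?_
  rw [sub_mul, mon_mul, mon_mul, map_sub, phiT_mon, phiT_mon]
  have : v + z ∈ T ↔ w + z ∈ T := by
    constructor
    · intro hz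
      have := (h _ hz).1 (fun k => Nat.le_add_right _ _)
      rwa [add_tsub_cancel_left] at this
    · intro hz
      have := (h _ hz).2 (fun k => Nat.le_add_right _ _)
      rwa [add_tsub_cancel_left] at this
  simp [this]

theorem hf_mon {T : Finset (Fin n → ℕ)} {i r : ℕ} (e f : Fin r → Fin n → ℕ)
    (he : ∀ a, ∑ j, e a j = i) (hdual : ∀ a b, e a + f b ∈ T ↔ a = b)
    (hspan : piece (annI (phiT K T)) i ≤ Submodule.span K
      (Set.range fun a => Ideal.Quotient.mk (annI (phiT K T)) (mon K (e a)))) :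
    hf (annI (phiT K T)) i = r := by
  have h1 : piece (annI (phiT K T)) i = Submodule.span K
      (Set.range fun a => Ideal.Quotient.mk (annI (phiT K T)) (mon K (e a))) := by
    refine le_antisymm hspan (Submodule.span_le.2 ?_)
    rintro _ ⟨a, rfl⟩
    exact mk_mem_piece (mon_homog (he a))
  have hli : LinearIndependent K
      (fun a => Ideal.Quotient.mk (annI (phiT K T)) (mon K (e a))) := by
    rw [Fintype.linearIndependent_iff]
    intro g hg b
    have h2 := congrArg (fun z => psi (phiT K T) (z * Ideal.Quotient.mk _ (mon K (f b)))) hg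
    simp only [Finset.sum_mul, map_sum, smul_mul_assoc, map_smul, ← map_mul, psi_mk, mon_mul,
      phiT_mon, hdual, zero_mul, map_zero] at h2
    simpa using h2
  rw [hf, h1, finrank_span_eq_card hli, Fintype.card_fin]

theorem piece_one_le (I : Ideal (MvPolynomial (Fin n) K)) :
    piece I 1 ≤ Submodule.span K (Set.range fun j => Ideal.Quotient.mk I (X j)) := by
  refine (piece_succ_le I 0).trans (Submodule.span_le.2 ?_)
  rintro _ ⟨j, a, ha, rfl⟩
  obtain ⟨c, rfl⟩ := Submodule.mem_span_singleton.1 (piece_zero_le I ha)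
  rw [mul_smul_comm, mul_one]
  exact Submodule.smul_mem _ _ (Submodule.subset_span ⟨j, rfl⟩)

theorem piece_two_le (I : Ideal (MvPolynomial (Fin n) K))
    (S : Submodule K (MvPolynomial (Fin n) K ⧸ I))
    (h : ∀ i j, Ideal.Quotient.mk I (X i * X j) ∈ S) : piece I 2 ≤ S := by
  refine (piece_succ_le I 1).trans (Submodule.span_le.2 ?_)
  rintro _ ⟨i, a, ha, rfl⟩
  have h1 : Submodule.span K (Set.range fun j => Ideal.Quotient.mk I (X j)) ≤
      S.comap (LinearMap.mulLeft K (Ideal.Quotient.mk I (X i))) := by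
    rw [Submodule.span_le]
    rintro _ ⟨j, rfl⟩
    have := h i j
    rw [map_mul] at this
    exact this
  exact h1 (piece_one_le I ha)

theorem hf_one {T : Finset (Fin n → ℕ)} (f : Fin n → Fin n → ℕ)
    (hdual : ∀ a b, Pi.single a 1 + f b ∈ T ↔ a = b) : hf (annI (phiT K T)) 1 = n := by
  refine hf_mon (fun a => Pi.single a 1) f (by simp) hdual ?_
  have := piece_one_le (annI (phiT K T))
  simpa only [X_eq_mon] using this

/-- If `hf 1 = hf 2`, and each linear form kills a nonzero linear form, the WLP fails. -/
theorem not_WLP {I : Ideal (MvPolynomial (Fin n) K)} (h12 : hf I 1 = hf I 2)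
    (h : ∀ t : Fin n → K, ∃ c : Fin n → K, lin (fun j => Ideal.Quotient.mk I (X j)) c ≠ 0 ∧
      lin (fun j => Ideal.Quotient.mk I (X j)) t * lin (fun j => Ideal.Quotient.mk I (X j)) c = 0) :
    ¬ WLP I := by
  rintro ⟨ℓ, hℓ, hw⟩
  have := (Submodule.fg_iff_finiteDimensional _).1 (piece_fg I 1)
  have := (Submodule.fg_iff_finiteDimensional _).1 (piece_fg I 2)
  obtain ⟨t, ht⟩ := (Submodule.mem_span_range_iff_exists_fun K).1
    (piece_one_le I (mk_mem_piece (I := I) hℓ))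
  obtain ⟨c, hc0, hc⟩ := h t
  have hcm : lin (fun j => Ideal.Quotient.mk I (X j)) c ∈ piece I 1 :=
    Submodule.sum_mem _ fun j _ => Submodule.smul_mem _ _ (mk_mem_piece (isHomogeneous_X _ _))
  have ht' : lin (fun j => Ideal.Quotient.mk I (X j)) t = Ideal.Quotient.mk I ℓ := ht
  rw [ht'] at hc
  have hinj : ∀ a ∈ piece I 1, Ideal.Quotient.mk I ℓ * a = 0 → a = 0 := by
    rcases hw 1 with h1 | h1
    · exact h1
    · let f : piece I 1 →ₗ[K] piece I 2 :=
        ((LinearMap.mulLeft K (Ideal.Quotient.mk I ℓ)).comp (piece I 1).subtype).codRestrict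
          (piece I 2) (fun a => piece_mul_mem (mk_mem_piece hℓ) a.2)
      have hs : Function.Surjective f := by
        rintro ⟨b, hb⟩
        obtain ⟨a, ha, hab⟩ := h1 b hb
        exact ⟨⟨a, ha⟩, Subtype.ext hab⟩
      have hi := (LinearMap.injective_iff_surjective_of_finrank_eq_finrank h12).2 hs
      intro a ha h0
      have := (injective_iff_map_eq_zero f).1 hi ⟨a, ha⟩ (Subtype.ext h0)
      exact congrArg Subtype.val this
  exact hc0 (hinj _ hcm hc)

theorem lin_ne {T : Finset (Fin n → ℕ)} (f : Fin n → ℕ) (b : Fin n)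
    (hdual : ∀ a, Pi.single a 1 + f ∈ T ↔ a = b) {c : Fin n → K} (hc : c b ≠ 0) :
    lin (fun j => Ideal.Quotient.mk (annI (phiT K T)) (X j)) c ≠ 0 := by
  intro h
  apply hc
  have h2 := congrArg (fun z => psi (phiT K T) (z * Ideal.Quotient.mk _ (mon K f))) h
  simp only [lin, Finset.sum_mul, map_sum, smul_mul_assoc, map_smul, ← map_mul, psi_mk, X_eq_mon,
    mon_mul, phiT_mon, hdual, zero_mul, map_zero] at h2
  simpa using h2

end MonomialFunctional



section Examples

/-- Exponents of the cubic `x₀u² + x₁uv + x₂v²`. -/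
def T5 : Finset (Fin 5 → ℕ) := {![1,0,0,2,0], ![0,1,0,1,1], ![0,0,1,0,2]}

/-- Dual quadrics for the cubic. -/
def f5 : Fin 5 → Fin 5 → ℕ :=
  ![![0,0,0,2,0], ![0,0,0,1,1], ![0,0,0,0,2], ![1,0,0,1,0], ![0,1,0,1,0]]

/-- Exponents of the cubic `x₀u² + x₁uv + x₂v² + w³`. -/
def T6 : Finset (Fin 6 → ℕ) := {![1,0,0,2,0,0], ![0,1,0,1,1,0], ![0,0,1,0,2,0], ![0,0,0,0,0,3]}

/-- Dual quadrics for the cubic. -/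
def f6 : Fin 6 → Fin 6 → ℕ :=
  ![![0,0,0,2,0,0], ![0,0,0,1,1,0], ![0,0,0,0,2,0], ![1,0,0,1,0,0], ![0,1,0,1,0,0],
    ![0,0,0,0,0,2]]

/-- Exponents of the quartic `x₀u³ + x₁u²v + x₂uv² + x₃v³`. -/
def T4 : Finset (Fin 6 → ℕ) := {![1,0,0,0,3,0], ![0,1,0,0,2,1], ![0,0,1,0,1,2], ![0,0,0,1,0,3]}

/-- Dual cubics for the quartic. -/
def f4 : Fin 6 → Fin 6 → ℕ :=
  ![![0,0,0,0,3,0], ![0,0,0,0,2,1], ![0,0,0,0,1,2], ![0,0,0,0,0,3], ![1,0,0,0,2,0],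
    ![0,1,0,0,2,0]]

/-- Basis of quadrics for the quartic. -/
def e4 : Fin 6 → Fin 6 → ℕ :=
  ![![1,0,0,0,1,0], ![0,1,0,0,1,0], ![0,0,1,0,1,0], ![0,0,0,0,2,0], ![0,0,0,0,1,1],
    ![0,0,0,0,0,2]]

/-- Dual basis of quadrics for the quartic. -/
def g4 : Fin 6 → Fin 6 → ℕ :=
  ![![0,0,0,0,2,0], ![0,0,0,0,1,1], ![0,0,0,0,0,2], ![1,0,0,0,1,0], ![0,1,0,0,1,0],
    ![0,0,1,0,1,0]]

theorem T5_deg : ∀ v ∈ T5, ∑ j, v j = 3 := by decide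
theorem T6_deg : ∀ v ∈ T6, ∑ j, v j = 3 := by decide
theorem T4_deg : ∀ v ∈ T4, ∑ j, v j = 4 := by decide

theorem T5_dual : ∀ a b, Pi.single a 1 + f5 b ∈ T5 ↔ a = b := by decide
theorem T6_dual : ∀ a b, Pi.single a 1 + f6 b ∈ T6 ↔ a = b := by decide
theorem T4_dual : ∀ a b, Pi.single a 1 + f4 b ∈ T4 ↔ a = b := by decide
theorem e4_dual : ∀ a b, e4 a + g4 b ∈ T4 ↔ a = b := by decide

theorem T4_span : ∀ i j : Fin 6,
    (∀ t ∈ T4, ¬ ∀ k, (Pi.single i 1 + Pi.single j 1 : Fin 6 → ℕ) k ≤ t k) ∨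
    ∃ a, ∀ t ∈ T4, ((∀ k, (Pi.single i 1 + Pi.single j 1 : Fin 6 → ℕ) k ≤ t k) →
      e4 a + (t - (Pi.single i 1 + Pi.single j 1)) ∈ T4) ∧
      ((∀ k, e4 a k ≤ t k) → (Pi.single i 1 + Pi.single j 1) + (t - e4 a) ∈ T4) := by
  decide +kernel

variable {K : Type*} [Field K]

theorem XX_zero {n : ℕ} {T : Finset (Fin n → ℕ)} (i j : Fin n)
    (h : ∀ t ∈ T, ¬ ∀ k, (Pi.single i 1 + Pi.single j 1 : Fin n → ℕ) k ≤ t k) :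
    Ideal.Quotient.mk (annI (phiT K T)) (X i) * Ideal.Quotient.mk (annI (phiT K T)) (X j) = 0 := by
  rw [← map_mul, X_eq_mon, X_eq_mon, mon_mul]
  exact mon_zero h

theorem XX_eq {n : ℕ} {T : Finset (Fin n → ℕ)} (i j i' j' : Fin n)
    (h : ∀ t ∈ T, ((∀ k, (Pi.single i 1 + Pi.single j 1 : Fin n → ℕ) k ≤ t k) →
      (Pi.single i' 1 + Pi.single j' 1) + (t - (Pi.single i 1 + Pi.single j 1)) ∈ T) ∧
      ((∀ k, (Pi.single i' 1 + Pi.single j' 1 : Fin n → ℕ) k ≤ t k) →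
      (Pi.single i 1 + Pi.single j 1) + (t - (Pi.single i' 1 + Pi.single j' 1)) ∈ T)) :
    Ideal.Quotient.mk (annI (phiT K T)) (X i) * Ideal.Quotient.mk (annI (phiT K T)) (X j) =
    Ideal.Quotient.mk (annI (phiT K T)) (X i') * Ideal.Quotient.mk (annI (phiT K T)) (X j') := by
  rw [← map_mul, ← map_mul, X_eq_mon, X_eq_mon, X_eq_mon, X_eq_mon, mon_mul, mon_mul]
  exact mon_eq h

theorem phiT_ne {n : ℕ} {T : Finset (Fin n → ℕ)} (v : Fin n → ℕ) (h : v ∈ T) : phiT K T ≠ 0 := by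
  intro h0
  have := phiT_mon (K := K) T v
  rw [if_pos h, h0] at this
  simp at this

theorem T5_AG : IsArtinianGorenstein (annI (phiT K T5)) 3 :=
  annI_AG (phiT_hom T5_deg) (phiT_ne ![1,0,0,2,0] (by decide))

theorem T6_AG : IsArtinianGorenstein (annI (phiT K T6)) 3 :=
  annI_AG (phiT_hom T6_deg) (phiT_ne ![1,0,0,2,0,0] (by decide))

theorem T4_AG : IsArtinianGorenstein (annI (phiT K T4)) 4 :=
  annI_AG (phiT_hom T4_deg) (phiT_ne ![1,0,0,0,3,0] (by decide))

theorem T4_two : hf (annI (phiT K T4)) 2 = 6 := by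
  refine hf_mon e4 g4 (by decide) e4_dual (piece_two_le _ _ fun i j => ?_)
  rw [X_eq_mon, X_eq_mon, mon_mul]
  rcases T4_span i j with h | ⟨a, h⟩
  · rw [mon_zero h]; exact Submodule.zero_mem _
  · rw [mon_eq h]; exact Submodule.subset_span ⟨a, rfl⟩

theorem ker5 {A : Type*} [CommRing A] [Algebra K A] (y : Fin 5 → A) (t : Fin 5 → K)
    (r00 : y 0 * y 0 = 0) (r01 : y 0 * y 1 = 0) (r02 : y 0 * y 2 = 0) (r11 : y 1 * y 1 = 0)
    (r12 : y 1 * y 2 = 0) (r22 : y 2 * y 2 = 0) (r40 : y 4 * y 0 = 0) (r32 : y 3 * y 2 = 0)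
    (s0 : y 3 * y 0 = y 4 * y 1) (s1 : y 3 * y 1 = y 4 * y 2) :
    lin y t * lin y ![t 4 ^ 2, - (t 3 * t 4), t 3 ^ 2, 0, 0] = 0 := by
  have h : lin y ![t 4 ^ 2, - (t 3 * t 4), t 3 ^ 2, 0, 0] =
      t 4 ^ 2 • y 0 + (- (t 3 * t 4)) • y 1 + t 3 ^ 2 • y 2 := by
    rw [lin, Fin.sum_univ_five]
    simp
  rw [h, lin, Fin.sum_univ_five]
  simp only [Algebra.smul_def, map_mul, map_pow, map_neg]
  generalize algebraMap K A (t 0) = c0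
  generalize algebraMap K A (t 1) = c1
  generalize algebraMap K A (t 2) = c2
  generalize algebraMap K A (t 3) = c3
  generalize algebraMap K A (t 4) = c4
  linear_combination (c0 * c4 ^ 2) * r00 + (c1 * c4 ^ 2 - c0 * c3 * c4) * r01
    + (c2 * c4 ^ 2 + c0 * c3 ^ 2) * r02 - c1 * c3 * c4 * r11
    + (c1 * c3 ^ 2 - c2 * c3 * c4) * r12 + c2 * c3 ^ 2 * r22 + c4 ^ 3 * r40 + c3 ^ 3 * r32
    + c3 * c4 ^ 2 * s0 - c3 ^ 2 * c4 * s1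

theorem ker6 {A : Type*} [CommRing A] [Algebra K A] (y : Fin 6 → A) (t : Fin 6 → K)
    (r00 : y 0 * y 0 = 0) (r01 : y 0 * y 1 = 0) (r02 : y 0 * y 2 = 0) (r11 : y 1 * y 1 = 0)
    (r12 : y 1 * y 2 = 0) (r22 : y 2 * y 2 = 0) (r40 : y 4 * y 0 = 0) (r32 : y 3 * y 2 = 0)
    (r50 : y 5 * y 0 = 0) (r51 : y 5 * y 1 = 0) (r52 : y 5 * y 2 = 0)
    (s0 : y 3 * y 0 = y 4 * y 1) (s1 : y 3 * y 1 = y 4 * y 2) :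
    lin y t * lin y ![t 4 ^ 2, - (t 3 * t 4), t 3 ^ 2, 0, 0, 0] = 0 := by
  have h : lin y ![t 4 ^ 2, - (t 3 * t 4), t 3 ^ 2, 0, 0, 0] =
      t 4 ^ 2 • y 0 + (- (t 3 * t 4)) • y 1 + t 3 ^ 2 • y 2 := by
    rw [lin, Fin.sum_univ_six]
    simp
  rw [h, lin, Fin.sum_univ_six]
  simp only [Algebra.smul_def, map_mul, map_pow, map_neg]
  generalize algebraMap K A (t 0) = c0
  generalize algebraMap K A (t 1) = c1
  generalize algebraMap K A (t 2) = c2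
  generalize algebraMap K A (t 3) = c3
  generalize algebraMap K A (t 4) = c4
  generalize algebraMap K A (t 5) = c5
  linear_combination (c0 * c4 ^ 2) * r00 + (c1 * c4 ^ 2 - c0 * c3 * c4) * r01
    + (c2 * c4 ^ 2 + c0 * c3 ^ 2) * r02 - c1 * c3 * c4 * r11
    + (c1 * c3 ^ 2 - c2 * c3 * c4) * r12 + c2 * c3 ^ 2 * r22 + c4 ^ 3 * r40 + c3 ^ 3 * r32
    + c3 * c4 ^ 2 * s0 - c3 ^ 2 * c4 * s1
    + c5 * c4 ^ 2 * r50 - c5 * c3 * c4 * r51 + c5 * c3 ^ 2 * r52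

theorem ker4 {A : Type*} [CommRing A] [Algebra K A] (y : Fin 6 → A) (t : Fin 6 → K)
    (r00 : y 0 * y 0 = 0) (r01 : y 0 * y 1 = 0) (r02 : y 0 * y 2 = 0) (r03 : y 0 * y 3 = 0)
    (r11 : y 1 * y 1 = 0) (r12 : y 1 * y 2 = 0) (r13 : y 1 * y 3 = 0) (r22 : y 2 * y 2 = 0)
    (r23 : y 2 * y 3 = 0) (r33 : y 3 * y 3 = 0) (r50 : y 5 * y 0 = 0) (r43 : y 4 * y 3 = 0)
    (s0 : y 4 * y 0 = y 5 * y 1) (s1 : y 4 * y 1 = y 5 * y 2) (s2 : y 4 * y 2 = y 5 * y 3) :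
    lin y t * lin y ![t 5 ^ 3, - (t 4 * t 5 ^ 2), t 4 ^ 2 * t 5, - t 4 ^ 3, 0, 0] = 0 := by
  have h : lin y ![t 5 ^ 3, - (t 4 * t 5 ^ 2), t 4 ^ 2 * t 5, - t 4 ^ 3, 0, 0] =
      t 5 ^ 3 • y 0 + (- (t 4 * t 5 ^ 2)) • y 1 + (t 4 ^ 2 * t 5) • y 2 + (- t 4 ^ 3) • y 3 := by
    rw [lin, Fin.sum_univ_six]
    simp
  rw [h, lin, Fin.sum_univ_six]
  simp only [Algebra.smul_def, map_mul, map_pow, map_neg]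
  generalize algebraMap K A (t 0) = c0
  generalize algebraMap K A (t 1) = c1
  generalize algebraMap K A (t 2) = c2
  generalize algebraMap K A (t 3) = c3
  generalize algebraMap K A (t 4) = p
  generalize algebraMap K A (t 5) = q
  linear_combination c0 * q ^ 3 * r00 + (c1 * q ^ 3 - c0 * p * q ^ 2) * r01
    + (c2 * q ^ 3 + c0 * p ^ 2 * q) * r02 + (c3 * q ^ 3 - c0 * p ^ 3) * r03
    - c1 * p * q ^ 2 * r11 + (c1 * p ^ 2 * q - c2 * p * q ^ 2) * r12
    + (- c1 * p ^ 3 - c3 * p * q ^ 2) * r13 + c2 * p ^ 2 * q * r22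
    + (c3 * p ^ 2 * q - c2 * p ^ 3) * r23 - c3 * p ^ 3 * r33 + q ^ 4 * r50 - p ^ 4 * r43
    + p * q ^ 3 * s0 - p ^ 2 * q ^ 2 * s1 + p ^ 3 * q * s2

theorem T5_not_WLP : ¬ WLP (annI (phiT K T5)) := by
  refine not_WLP (T5_AG.2.2.2.1 1 (by norm_num)) fun t => ?_
  have r00 := XX_zero (K := K) (T := T5) 0 0 (by decide)
  by_cases ht : t 3 = 0 ∧ t 4 = 0
  · refine ⟨Pi.single 0 1, lin_ne (f5 0) 0 (fun a => T5_dual a 0) (by simp), ?_⟩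
    have r10 := XX_zero (K := K) (T := T5) 1 0 (by decide)
    have r20 := XX_zero (K := K) (T := T5) 2 0 (by decide)
    simp [lin, Fin.sum_univ_five, Pi.single_apply, ht, add_mul, r00, r10, r20]
  · refine ⟨![t 4 ^ 2, - (t 3 * t 4), t 3 ^ 2, 0, 0], ?_, ?_⟩
    · by_cases h3 : t 3 = 0
      · exact lin_ne (f5 0) 0 (fun a => T5_dual a 0) (by simp; tauto)
      · exact lin_ne (f5 2) 2 (fun a => T5_dual a 2) (by simp; tauto)
    · exact ker5 _ t r00 (XX_zero 0 1 (by decide)) (XX_zero 0 2 (by decide))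
        (XX_zero 1 1 (by decide)) (XX_zero 1 2 (by decide)) (XX_zero 2 2 (by decide))
        (XX_zero 4 0 (by decide)) (XX_zero 3 2 (by decide))
        (XX_eq 3 0 4 1 (by decide)) (XX_eq 3 1 4 2 (by decide))

theorem T6_not_WLP : ¬ WLP (annI (phiT K T6)) := by
  refine not_WLP (T6_AG.2.2.2.1 1 (by norm_num)) fun t => ?_
  have r00 := XX_zero (K := K) (T := T6) 0 0 (by decide)
  by_cases ht : t 3 = 0 ∧ t 4 = 0
  · refine ⟨Pi.single 0 1, lin_ne (f6 0) 0 (fun a => T6_dual a 0) (by simp), ?_⟩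
    have r10 := XX_zero (K := K) (T := T6) 1 0 (by decide)
    have r20 := XX_zero (K := K) (T := T6) 2 0 (by decide)
    have r50 := XX_zero (K := K) (T := T6) 5 0 (by decide)
    simp [lin, Fin.sum_univ_six, Pi.single_apply, ht, add_mul, r00, r10, r20, r50]
  · refine ⟨![t 4 ^ 2, - (t 3 * t 4), t 3 ^ 2, 0, 0, 0], ?_, ?_⟩
    · by_cases h3 : t 3 = 0
      · exact lin_ne (f6 0) 0 (fun a => T6_dual a 0) (by simp; tauto)
      · exact lin_ne (f6 2) 2 (fun a => T6_dual a 2) (by simp; tauto)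
    · exact ker6 _ t r00 (XX_zero 0 1 (by decide)) (XX_zero 0 2 (by decide))
        (XX_zero 1 1 (by decide)) (XX_zero 1 2 (by decide)) (XX_zero 2 2 (by decide))
        (XX_zero 4 0 (by decide)) (XX_zero 3 2 (by decide))
        (XX_zero 5 0 (by decide)) (XX_zero 5 1 (by decide)) (XX_zero 5 2 (by decide))
        (XX_eq 3 0 4 1 (by decide)) (XX_eq 3 1 4 2 (by decide))

theorem T4_not_WLP : ¬ WLP (annI (phiT K T4)) := by
  refine not_WLP ((hf_one f4 T4_dual).trans T4_two.symm) fun t => ?_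
  have r00 := XX_zero (K := K) (T := T4) 0 0 (by decide)
  by_cases ht : t 4 = 0 ∧ t 5 = 0
  · refine ⟨Pi.single 0 1, lin_ne (f4 0) 0 (fun a => T4_dual a 0) (by simp), ?_⟩
    have r10 := XX_zero (K := K) (T := T4) 1 0 (by decide)
    have r20 := XX_zero (K := K) (T := T4) 2 0 (by decide)
    have r30 := XX_zero (K := K) (T := T4) 3 0 (by decide)
    simp [lin, Fin.sum_univ_six, Pi.single_apply, ht, add_mul, r00, r10, r20, r30]
  · refine ⟨![t 5 ^ 3, - (t 4 * t 5 ^ 2), t 4 ^ 2 * t 5, - t 4 ^ 3, 0, 0], ?_, ?_⟩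
    · by_cases h3 : t 4 = 0
      · exact lin_ne (f4 0) 0 (fun a => T4_dual a 0) (by simp; tauto)
      · exact lin_ne (f4 3) 3 (fun a => T4_dual a 3) (by simp; tauto)
    · exact ker4 _ t r00 (XX_zero 0 1 (by decide)) (XX_zero 0 2 (by decide))
        (XX_zero 0 3 (by decide)) (XX_zero 1 1 (by decide)) (XX_zero 1 2 (by decide))
        (XX_zero 1 3 (by decide)) (XX_zero 2 2 (by decide)) (XX_zero 2 3 (by decide))
        (XX_zero 3 3 (by decide)) (XX_zero 5 0 (by decide)) (XX_zero 4 3 (by decide))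
        (XX_eq 4 0 5 1 (by decide)) (XX_eq 4 1 5 2 (by decide)) (XX_eq 4 2 5 3 (by decide))

theorem hf_eq_of_le {n : ℕ} {I : Ideal (MvPolynomial (Fin n) K)} {d : ℕ} {h : ℕ → ℕ}
    (hI : IsArtinianGorenstein I d) (h0 : ∀ i, d < i → h i = 0)
    (hle : ∀ i ≤ d, hf I i = h i) : ∀ i, hf I i = h i := by
  intro i
  by_cases hi : i ≤ d
  · exact hle i hi
  · rw [hI.2.2.1 i (by omega), h0 i (by omega)]

end Examples

theorem wlp_classification_sperner_le_six {K : Type*} [Field K] [IsAlgClosed K]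
    [CharZero K] (h : ℕ → ℕ) (d : ℕ)
    (hgor : ∃ (n : ℕ) (I : Ideal (MvPolynomial (Fin n) K)),
      IsArtinianGorenstein I d ∧ ∀ i : ℕ, hf I i = h i)
    (hsperner : ∀ i : ℕ, h i ≤ 6) :
    (∀ (n : ℕ) (I : Ideal (MvPolynomial (Fin n) K)),
        IsArtinianGorenstein I d → (∀ i : ℕ, hf I i = h i) → WLP I) ↔
      ¬ ((d = 3 ∧ h 0 = 1 ∧ h 1 = 5 ∧ h 2 = 5 ∧ h 3 = 1) ∨
         (d = 3 ∧ h 0 = 1 ∧ h 1 = 6 ∧ h 2 = 6 ∧ h 3 = 1) ∨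
         (d = 4 ∧ h 0 = 1 ∧ h 1 = 6 ∧ h 2 = 6 ∧ h 3 = 6 ∧ h 4 = 1)) := by
  obtain ⟨n0, I0, hI0, hh0⟩ := hgor
  have hzero : ∀ i, d < i → h i = 0 := fun i hi => by rw [← hh0, hI0.2.2.1 i hi]
  have hd1 : h d = 1 := by rw [← hh0, hI0.2.1]
  have hsym : ∀ i ≤ d, h i = h (d - i) := fun i hi => by
    rw [← hh0, ← hh0, hI0.2.2.2.1 i hi]
  constructor
  · rintro hall (⟨rfl, a0, a1, a2, a3⟩ | ⟨rfl, a0, a1, a2, a3⟩ | ⟨rfl, a0, a1, a2, a3, a4⟩)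
    · refine T5_not_WLP (hall 5 _ (T5_AG (K := K)) (hf_eq_of_le T5_AG hzero fun i hi => ?_))
      have e1 : hf (annI (phiT K T5)) 1 = 5 := hf_one f5 T5_dual
      have e3 := (T5_AG (K := K)).2.1
      have e2 := (T5_AG (K := K)).2.2.2.1 2 (by norm_num)
      have e0 := (T5_AG (K := K)).2.2.2.1 0 (by norm_num)
      simp only [Nat.reduceSub, Nat.sub_zero] at e2 e0
      interval_cases i <;> omega
    · refine T6_not_WLP (hall 6 _ (T6_AG (K := K)) (hf_eq_of_le T6_AG hzero fun i hi => ?_))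
      have e1 : hf (annI (phiT K T6)) 1 = 6 := hf_one f6 T6_dual
      have e3 := (T6_AG (K := K)).2.1
      have e2 := (T6_AG (K := K)).2.2.2.1 2 (by norm_num)
      have e0 := (T6_AG (K := K)).2.2.2.1 0 (by norm_num)
      simp only [Nat.reduceSub, Nat.sub_zero] at e2 e0
      interval_cases i <;> omega
    · refine T4_not_WLP (hall 6 _ (T4_AG (K := K)) (hf_eq_of_le T4_AG hzero fun i hi => ?_))
      have e1 : hf (annI (phiT K T4)) 1 = 6 := hf_one f4 T4_dual
      have e2 : hf (annI (phiT K T4)) 2 = 6 := T4_two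
      have e4 := (T4_AG (K := K)).2.1
      have e3 := (T4_AG (K := K)).2.2.2.1 3 (by norm_num)
      have e0 := (T4_AG (K := K)).2.2.2.1 0 (by norm_num)
      simp only [Nat.reduceSub, Nat.sub_zero] at e3 e0
      interval_cases i <;> omega
  · intro hne n I hI hh
    refine wlp_of_AG hI (fun i => by rw [hh]; exact hsperner i) ?_ ?_
    · rintro rfl
      rw [hh]
      by_contra hlt
      have e1 := hsperner 1
      have e2 := hsym 1 (by norm_num)
      have e3 := hsym 0 (by norm_num)
      simp only [Nat.reduceSub, Nat.sub_zero] at e2 e3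
      apply hne
      omega
    · rintro rfl ⟨b1, b2⟩
      rw [hh] at b1 b2
      have e2 := hsym 1 (by norm_num)
      have e3 := hsym 0 (by norm_num)
      simp only [Nat.reduceSub, Nat.sub_zero] at e2 e3
      apply hne
      omega
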